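/- arXiv:1412.2947 — 4 statements merged into one kernel-verified Lean document; each statement's English description precedes it below -/
import Mathlib

section
/- Let q be an odd prime, a ∈ Z_q, n ≥ 4, and let ᵃf be a quadratic partial function of n + 1 arguments on Ω_a. If for every index i ∈ {1,…,n,0} and every constant b ∈ Z_q the partial function of n arguments obtained from ᵃf by fixing the i-th argument to b is separable, then ᵃf itself is separable. -/
/-- `W`-separability of the partial function of `m` arguments that is the restriction of
`F` to the set `Ω_c` of tuples with coordinate sum `c`: it splits into a sum of a function
of the arguments indexed by `W` and a function of the remaining arguments. -/
def PFunWSep {q m : ℕ} (c : ZMod q) (F : (Fin m → ZMod q) → ZMod q)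
    (W : Set (Fin m)) : Prop :=
  ∃ (f' : (↥W → ZMod q) → ZMod q) (f'' : (↥Wᶜ → ZMod q) → ZMod q),
    ∀ x : Fin m → ZMod q, ∑ i, x i = c →
      F x = f' (fun i => x i) + f'' (fun i => x i)

/-- A partial function of `m` arguments is separable if it is `W`-separable for some `W`
with `2 ≤ |W| ≤ m - 2`. -/
def PFunSeparable {q m : ℕ} (c : ZMod q) (F : (Fin m → ZMod q) → ZMod q) : Prop :=
  ∃ W : Set (Fin m), 2 ≤ W.ncard ∧ W.ncard ≤ m - 2 ∧ PFunWSep c F W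

/-- `W` is a cut of `S` for the weights `c` if the weights between `W` and `S \ W` are a sum of
a function on `W` and a function on `S \ W`. -/
def IsCut {ι K : Type*} [Field K] (c : ι → ι → K) (S W : Finset ι) : Prop :=
  ∀ i ∈ W, ∀ j ∈ W, ∀ k ∈ S, k ∉ W → ∀ l ∈ S, l ∉ W → c i k + c j l = c i l + c j k

/-- `S` has a cut with at least two elements on either side. -/
def Decomposable {ι K : Type*} [DecidableEq ι] [Field K] (c : ι → ι → K) (S : Finset ι) : Prop :=
  ∃ W ⊆ S, 2 ≤ W.card ∧ 2 ≤ (S \ W).card ∧ IsCut c S W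

/-- The weights at `u` and at `x` differ by a constant on `S \ {x, u}`. -/
def Twin {ι K : Type*} [Field K] (c : ι → ι → K) (S : Finset ι) (x u : ι) : Prop :=
  ∃ α, ∀ k ∈ S, k ≠ x → k ≠ u → c u k = c x k + α

section Cuts

variable {ι K : Type*} [Field K] {c : ι → ι → K} {S X W : Finset ι}

theorem IsCut.exists_shift (h : IsCut c S W) {i j : ι} (hi : i ∈ W) (hj : j ∈ W) :
    ∃ α, ∀ k ∈ S, k ∉ W → c i k = c j k + α := by
  by_cases hne : ∃ l ∈ S, l ∉ W
  · obtain ⟨l, hl, hlW⟩ := hne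
    refine ⟨c i l - c j l, fun k hk hkW => ?_⟩
    linear_combination h i hi j hj k hk hkW l hl hlW
  · push Not at hne
    exact ⟨0, fun k hk hkW => absurd (hne k hk) hkW⟩

theorem isCut_of_shift (x : ι) (h : ∀ i ∈ W, ∃ α, ∀ k ∈ S, k ∉ W → c i k = c x k + α) :
    IsCut c S W := by
  intro i hi j hj k hk hkW l hl hlW
  obtain ⟨α, hα⟩ := h i hi
  obtain ⟨β, hβ⟩ := h j hj
  rw [hα k hk hkW, hα l hl hlW, hβ k hk hkW, hβ l hl hlW]
  ring

theorem Twin.symm {x u : ι} (h : Twin c S x u) : Twin c S u x := by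
  obtain ⟨α, hα⟩ := h
  exact ⟨-α, fun k hk h1 h2 => by rw [hα k hk h2 h1]; ring⟩

theorem Twin.mono {x u : ι} (h : Twin c S x u) (hX : X ⊆ S) : Twin c X x u := by
  obtain ⟨α, hα⟩ := h
  exact ⟨α, fun k hk h1 h2 => hα k (hX hk) h1 h2⟩

theorem Twin.trans {x u v : ι} (h : Twin c S x u) (h' : Twin c S u v) (hu : u ∉ S) :
    Twin c S x v := by
  obtain ⟨α, hα⟩ := h
  obtain ⟨β, hβ⟩ := h'
  refine ⟨α + β, fun k hk h1 h2 => ?_⟩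
  have hku : k ≠ u := by rintro rfl; exact hu hk
  rw [hβ k hk hku h2, hα k hk h1 hku]
  ring

variable [DecidableEq ι]

theorem IsCut.compl (hc : ∀ i j, c i j = c j i) (h : IsCut c S W) :
    IsCut c S (S \ W) := by
  intro i hi j hj k hk hkW l hl hlW
  have := h k (by grind) l (by grind) i (by grind) (by grind) j (by grind) (by grind)
  rw [hc i k, hc j l, hc i l, hc j k]
  linear_combination this

theorem IsCut.restrict (h : IsCut c S W) (hX : X ⊆ S) : IsCut c X (W ∩ X) := by
  intro i hi j hj k hk hkW l hl hlW
  exact h i (by grind) j (by grind) k (by grind) (by grind) l (by grind) (by grind)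

theorem decomposable_of_twin {x u : ι} (hS : 4 ≤ S.card) (hx : x ∈ S) (hu : u ∈ S)
    (hxu : x ≠ u) (h : Twin c S x u) : Decomposable c S := by
  have hsub : ({x, u} : Finset ι) ⊆ S := by grind
  have hcard : ({x, u} : Finset ι).card = 2 := Finset.card_pair hxu
  refine ⟨{x, u}, hsub, hcard.ge, ?_, isCut_of_shift x fun i hi => ?_⟩
  · rw [Finset.card_sdiff_of_subset hsub]; omega
  · obtain ⟨α, hα⟩ := h
    rcases Finset.mem_insert.1 hi with rfl | hi
    · exact ⟨0, by simp⟩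
    · obtain rfl := Finset.mem_singleton.1 hi
      exact ⟨α, fun k hk hkW => hα k hk (by grind) (by grind)⟩

theorem twin_unique (hX : ¬ Decomposable c X) (hcard : 4 ≤ X.card) {x y u : ι} (hx : x ∈ X)
    (hy : y ∈ X) (hu : u ∉ X) (h : Twin c X x u) (h' : Twin c X y u) : x = y := by
  by_contra hxy
  exact hX (decomposable_of_twin hcard hx hy hxy (h.trans h'.symm hu))

/-- A cut of a superset of an indecomposable set `X` can be taken to meet `X` in at most
one element. -/
theorem exists_cut_of_superset (hc : ∀ i j, c i j = c j i) (hX : ¬ Decomposable c X)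
    (hXS : X ⊆ S) (h : Decomposable c S) :
    ∃ W ⊆ S, 2 ≤ W.card ∧ IsCut c S W ∧ (W ∩ X).card ≤ 1 := by
  obtain ⟨W, hWS, h1, h2, hcut⟩ := h
  by_cases hW : (W ∩ X).card ≤ 1
  · exact ⟨W, hWS, h1, hcut, hW⟩
  · refine ⟨S \ W, Finset.sdiff_subset, h2, hcut.compl hc, ?_⟩
    by_contra hW'
    refine hX ⟨W ∩ X, Finset.inter_subset_right, by omega, ?_, hcut.restrict hXS⟩
    have : X \ (W ∩ X) = (S \ W) ∩ X := by grind
    rw [this]; omega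

theorem exists_twin_of_insert (hc : ∀ i j, c i j = c j i) (hX : ¬ Decomposable c X) {u : ι}
    (h : Decomposable c (insert u X)) : ∃ x ∈ X, Twin c X x u := by
  obtain ⟨W, hWS, h2, hcut, h1⟩ := exists_cut_of_superset hc hX (Finset.subset_insert u X) h
  simp only [Finset.card_le_one, Finset.mem_inter, and_imp] at h1
  obtain ⟨i, hi, j, hj, hij⟩ := Finset.one_lt_card.1 h2
  have key : ∃ x ∈ X, x ∈ W ∧ u ∈ W := by grind
  obtain ⟨x, hx, hxW, huW⟩ := key
  obtain ⟨α, hα⟩ := hcut.exists_shift huW hxW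
  exact ⟨x, hx, α, fun k hk h3 h4 => hα k (by grind) (by grind)⟩

theorem exists_twin_of_insert_insert (hc : ∀ i j, c i j = c j i) (hX : ¬ Decomposable c X)
    {u v : ι} (hu : u ∉ X)
    (h : Decomposable c (insert u (insert v X))) :
    Twin c X u v ∨ (∃ x ∈ X, Twin c X x u ∧ Twin c X x v) ∨
      (∃ x ∈ X, Twin c (insert v X) x u) ∨ (∃ x ∈ X, Twin c (insert u X) x v) := by
  obtain ⟨W, hWS, h2, hcut, h1⟩ := exists_cut_of_superset hc hX
    ((Finset.subset_insert v X).trans (Finset.subset_insert u _)) h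
  simp only [Finset.card_le_one, Finset.mem_inter, and_imp] at h1
  obtain ⟨i, hi, j, hj, hij⟩ := Finset.one_lt_card.1 h2
  by_cases hWX : ∃ x ∈ X, x ∈ W
  · obtain ⟨x, hx, hxW⟩ := hWX
    right
    by_cases huW : u ∈ W
    · obtain ⟨α, hα⟩ := hcut.exists_shift huW hxW
      by_cases hvW : v ∈ W
      · obtain ⟨β, hβ⟩ := hcut.exists_shift hvW hxW
        exact Or.inl ⟨x, hx, ⟨α, fun k hk h3 h4 => hα k (by grind) (by grind)⟩,
          ⟨β, fun k hk h3 h4 => hβ k (by grind) (by grind)⟩⟩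
      · exact Or.inr (Or.inl ⟨x, hx, α, fun k hk h3 h4 => hα k (by grind) (by grind)⟩)
    · have hvW : v ∈ W := by grind
      obtain ⟨β, hβ⟩ := hcut.exists_shift hvW hxW
      exact Or.inr (Or.inr ⟨x, hx, β, fun k hk h3 h4 => hβ k (by grind) (by grind)⟩)
  · left
    have huv : u ∈ W ∧ v ∈ W := by grind
    obtain ⟨α, hα⟩ := hcut.exists_shift huv.2 huv.1
    exact ⟨α, fun k hk h3 h4 => hα k (by grind) (by grind)⟩

/-- An indecomposable proper subset of an indecomposable set can be enlarged by two elements. -/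
theorem exists_insert_insert (hc : ∀ i j, c i j = c j i) (hS : ¬ Decomposable c S)
    (hX : ¬ Decomposable c X) (hXS : X ⊆ S) (h4 : 4 ≤ X.card) (h2 : 2 ≤ (S \ X).card) :
    ∃ u ∈ S \ X, ∃ v ∈ S \ X, u ≠ v ∧ ¬ Decomposable c (insert u (insert v X)) := by
  classical
  by_contra! H
  by_cases hT : ∃ x ∈ X, ∃ u ∈ S \ X, Twin c X x u
  · obtain ⟨x, hx, u₀, hu₀, ht₀⟩ := hT
    set W := insert x ((S \ X).filter fun u => Twin c X x u) with hWdef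
    have hxW : x ∈ W := by grind
    have hu₀W : u₀ ∈ W := by grind
    have hXW : X.erase x ⊆ S \ W := by grind
    refine hS ⟨W, by grind, Finset.one_lt_card.2 ⟨x, hxW, u₀, hu₀W, by grind⟩, ?_,
      isCut_of_shift x fun u hu => ?_⟩
    · have := Finset.card_le_card hXW
      rw [Finset.card_erase_of_mem hx] at this
      omega
    · by_cases hux : u = x
      · subst hux
        exact ⟨0, by simp⟩
      have huS : u ∈ S \ X := by grind
      have hut : Twin c X x u := by grind
      have huX : u ∉ X := by grind
      obtain ⟨α, hα⟩ := id hut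
      refine ⟨α, fun k hk hkW => ?_⟩
      by_cases hkX : k ∈ X
      · exact hα k hkX (by grind) (by grind)
      have hkt : ¬ Twin c X x k := by grind
      have hku : u ≠ k := by grind
      rcases exists_twin_of_insert_insert hc hX huX (H u huS k (by grind) hku) with
        h | ⟨y, hy, h, h'⟩ | ⟨y, hy, h⟩ | ⟨y, hy, h⟩
      · exact absurd (hut.trans h huX) hkt
      · obtain rfl := twin_unique hX h4 hx hy huX hut h
        exact absurd h' hkt
      · obtain rfl := twin_unique hX h4 hx hy huX hut (h.mono (Finset.subset_insert _ _))
        obtain ⟨β, hβ⟩ := h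
        obtain ⟨z, hz, hzx⟩ := Finset.exists_mem_ne (by omega : 1 < X.card) x
        have h1 := hα z hz hzx (by grind)
        have h2 := hβ z (by grind) hzx (by grind)
        have h3 := hβ k (by grind) (by grind) hku.symm
        linear_combination h3 + h1 - h2
      · have hyx : y ≠ x := by
          rintro rfl
          exact hkt (h.mono (Finset.subset_insert _ _))
        obtain ⟨β, hβ⟩ := h
        have h1 := hα y hy hyx (by grind)
        have h2 := hβ x (by grind) hyx.symm (by grind)
        have h3 := hβ u (by grind) (by grind) hku
        rw [hc u k, hc x k, h3, h2, hc y u, h1, hc x y]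
        ring
  · push Not at hT
    obtain ⟨x, hx⟩ : (S \ X).Nonempty := Finset.card_pos.1 (by omega)
    have hdd : S \ (S \ X) = X := by grind
    refine hS ⟨S \ X, Finset.sdiff_subset, h2, by rw [hdd]; omega,
      isCut_of_shift x fun u hu => ?_⟩
    by_cases hux : u = x
    · subst hux
      exact ⟨0, by simp⟩
    have hxX : x ∉ X := by grind
    have huX : u ∉ X := by grind
    rcases exists_twin_of_insert_insert hc hX hxX (H x hx u hu (Ne.symm hux)) with
        ⟨α, hα⟩ | ⟨y, hy, h, h'⟩ | ⟨y, hy, h⟩ | ⟨y, hy, h⟩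
    · exact ⟨α, fun k hk hkW => hα k (by grind) (by grind) (by grind)⟩
    · exact absurd h (hT y hy x hx)
    · exact absurd (h.mono (Finset.subset_insert _ _)) (hT y hy x hx)
    · exact absurd (h.mono (Finset.subset_insert _ _)) (hT y hy u hu)

theorem exists_card_succ (hc : ∀ i j, c i j = c j i) (hS : ¬ Decomposable c S)
    (hX : ¬ Decomposable c X) (hXS : X ⊆ S) (h4 : 4 ≤ X.card) (hodd : Odd (S.card - X.card)) :
    ∃ Y ⊆ S, Y.card + 1 = S.card ∧ ¬ Decomposable c Y := by
  induction hn : S.card - X.card using Nat.strong_induction_on generalizing X with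
  | _ n ih =>
    have hcd := Finset.card_sdiff_of_subset hXS
    obtain ⟨m, hm⟩ := hodd
    rcases Nat.eq_zero_or_pos m with rfl | hmpos
    · exact ⟨X, hXS, by omega, hX⟩
    · obtain ⟨u, hu, v, hv, huv, hY⟩ := exists_insert_insert hc hS hX hXS h4 (by omega)
      have hcard : (insert u (insert v X)).card = X.card + 2 := by
        rw [Finset.card_insert_of_notMem (by grind), Finset.card_insert_of_notMem (by grind)]
      exact ih _ (by omega) hY (by grind) (by omega) ⟨m - 1, by omega⟩ rfl

theorem decomposable_quad {p r s t : ι} (h1 : p ≠ r) (h2 : p ≠ s) (h3 : p ≠ t) (h4 : r ≠ s)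
    (h5 : r ≠ t) (h6 : s ≠ t)
    (h : c p s + c r t = c p t + c r s) : Decomposable c {p, r, s, t} := by
  have hcard : ({p, r} : Finset ι).card = 2 := Finset.card_pair h1
  have hs : ({p, r, s, t} : Finset ι) \ {p, r} = {s, t} := by grind
  refine ⟨{p, r}, by grind, by omega, by rw [hs, Finset.card_pair h6], ?_⟩
  intro i hi j hj k hk hk' l hl hl'
  grind

theorem eq_of_decomposable_quad {p r s t : ι} (hc : ∀ i j, c i j = c j i)
    (h : Decomposable c {p, r, s, t}) :
    c p s + c r t = c p t + c r s ∨ c p r + c s t = c p t + c r s ∨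
      c p r + c s t = c p s + c r t := by
  obtain ⟨W, hWS, h1, h2, hcut⟩ := h
  obtain ⟨i, hi, j, hj, hij⟩ := Finset.one_lt_card.1 h1
  obtain ⟨k, hk, l, hl, hkl⟩ := Finset.one_lt_card.1 h2
  have h3 := hcut i hi j hj k (by grind) (by grind) l (by grind) (by grind)
  have hi' := hWS hi
  have hj' := hWS hj
  have hik : i ≠ k := by grind
  have hil : i ≠ l := by grind
  have hjk : j ≠ k := by grind
  have hjl : j ≠ l := by grind
  simp only [Finset.mem_sdiff, Finset.mem_insert, Finset.mem_singleton] at hi' hj' hk hl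
  have hk := hk.1
  have hl := hl.1
  clear hcut hi hj hWS h1 h2
  rcases hi' with rfl | rfl | rfl | rfl <;> rcases hj' with rfl | rfl | rfl | rfl <;>
    first | contradiction | skip
  all_goals
    rcases hk with rfl | rfl | rfl | rfl <;> first | contradiction | skip
  all_goals
    rcases hl with rfl | rfl | rfl | rfl <;> first | contradiction | skip
  all_goals grind

end Cuts

set_option maxHeartbeats 1000000 in
/-- A complete graph whose edges are coloured so that no triangle has three colours and no four
vertices split into two complementary two-coloured paths is a join along a single colour. -/
theorem exists_monochromatic_partition {ι κ : Type*} [DecidableEq ι]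
    (d : ι → ι → κ) (hd : ∀ i j, d i j = d j i) (V : Finset ι)
    (htri : ∀ i ∈ V, ∀ j ∈ V, ∀ k ∈ V, i ≠ j → i ≠ k → j ≠ k →
      d i j = d i k ∨ d i j = d j k ∨ d i k = d j k)
    (hpath : ∀ i ∈ V, ∀ j ∈ V, ∀ k ∈ V, ∀ l ∈ V, d i j = d j k → d j k = d k l →
      d i k = d i l → d i l = d j l → i ≠ j → i ≠ k → i ≠ l → j ≠ k → j ≠ l → k ≠ l →
      d i j = d i k)
    (hV : 2 ≤ V.card) :
    ∃ A ⊆ V, A.Nonempty ∧ (V \ A).Nonempty ∧ ∃ a, ∀ i ∈ A, ∀ j ∈ V, j ∉ A → d i j = a := by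
  induction V using Finset.induction_on with
  | empty => simp at hV
  | insert v V hv ih =>
    by_cases hV1 : 2 ≤ V.card
    · obtain ⟨A, hAV, ⟨x₁, hx₁⟩, ⟨x₂, hx₂⟩, a, ha⟩ := ih
        (fun i hi j hj k hk => htri i (by grind) j (by grind) k (by grind))
        (fun i hi j hj k hk l hl => hpath i (by grind) j (by grind) k (by grind) l (by grind)) hV1
      by_cases hA : ∀ x ∈ A, d v x = a
      · exact ⟨A, by grind, ⟨x₁, hx₁⟩, ⟨v, by grind⟩, a, by grind⟩
      by_cases hB : ∀ x ∈ V, x ∉ A → d v x = a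
      · exact ⟨insert v A, by grind, ⟨v, by grind⟩, ⟨x₂, by grind⟩, a, by grind⟩
      push Not at hA hB
      obtain ⟨y₁, hy₁, hvy₁⟩ := hA
      obtain ⟨y₂, hy₂, hy₂A, hvy₂⟩ := hB
      set b := d v y₁ with hb
      have hne : ∀ y ∈ V, y ≠ v := by grind
      have hb₂ : ∀ x ∈ V, x ∉ A → d v x ≠ a → d v x = b := by
        intro x hx hxA hvx
        have h1 := ha y₁ hy₁ x hx hxA
        have h2 := htri v (by grind) y₁ (by grind) x (by grind) (by grind) (by grind) (by grind)
        grind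
      have hb₁ : ∀ x ∈ A, d v x ≠ a → d v x = b := by
        intro x hx hvx
        have h1 := ha x hx y₂ hy₂ hy₂A
        have h2 := htri v (by grind) x (by grind) y₂ (by grind) (by grind) (by grind) (by grind)
        have h3 := hb₂ y₂ hy₂ hy₂A hvy₂
        grind
      by_cases hT : ∃ t ∈ V, d v t = a
      · obtain ⟨t₀, ht₀, hvt₀⟩ := hT
        classical
        refine ⟨V.filter fun t => d v t = a, by grind, ⟨t₀, by grind⟩, ⟨v, by grind⟩, a, ?_⟩
        have cross : ∀ t ∈ V, ∀ s ∈ V, ∀ s' ∈ V, d v t = a → d v s = b → d v s' = b →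
            d t s' = a → d s s' = a → d t s = a := by
          intro t ht s hs s' hs' hvt hvs hvs' hts' hss'
          have hts : t ≠ s := by grind
          by_cases hs's : s = s'
          · grind
          have h1 := htri v (by grind) t (by grind) s (by grind) (by grind) (by grind) hts
          have h2 := hpath t (by grind) s (by grind) v (by grind) s' (by grind)
          grind
        intro t ht s hs hs'
        have htV : t ∈ V := by grind
        have hvt : d v t = a := by grind
        by_cases hsv : s = v
        · grind
        have hsV : s ∈ V := by grind
        have hsa : d v s ≠ a := by grind
        by_cases htA : t ∈ A <;> by_cases hsA : s ∈ A
        · exact cross t htV s hsV y₂ hy₂ hvt (hb₁ s hsA hsa) (hb₂ y₂ hy₂ hy₂A hvy₂)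
            (ha t htA y₂ hy₂ hy₂A) (ha s hsA y₂ hy₂ hy₂A)
        · exact ha t htA s hsV hsA
        · rw [hd]
          exact ha s hsA t htV htA
        · exact cross t htV s hsV y₁ (hAV hy₁) hvt (hb₂ s hsV hsA hsa) rfl
            (by rw [hd]; exact ha y₁ hy₁ t htV htA) (by rw [hd]; exact ha y₁ hy₁ s hsV hsA)
      · push Not at hT
        refine ⟨{v}, by grind, ⟨v, by grind⟩, ⟨y₂, by grind⟩, b, ?_⟩
        grind
    · have h1 : V.card = 1 := by
        rw [Finset.card_insert_of_notMem hv] at hV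
        omega
      obtain ⟨w, rfl⟩ := Finset.card_eq_one.1 h1
      exact ⟨{v}, by grind, ⟨v, by grind⟩, ⟨w, by grind⟩, d v w, by grind⟩

section Small

variable {ι K : Type*} [DecidableEq ι] [Field K] {c : ι → ι → K} {S : Finset ι}

theorem exists_indecomposable_quad (h2 : (2 : K) ≠ 0) (hc : ∀ i j, c i j = c j i)
    (hS : ¬ Decomposable c S) (h4 : 4 ≤ S.card) :
    ∃ X ⊆ S, X.card = 4 ∧ ¬ Decomposable c X := by
  by_contra! H
  have hquad : ∀ p ∈ S, ∀ r ∈ S, ∀ s ∈ S, ∀ t ∈ S, p ≠ r → p ≠ s → p ≠ t → r ≠ s → r ≠ t →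
      s ≠ t → c p s + c r t = c p t + c r s ∨ c p r + c s t = c p t + c r s ∨
      c p r + c s t = c p s + c r t := by
    intro p hp r hr s hs t ht h1 h2 h3 h4 h5 h6
    refine eq_of_decomposable_quad hc (H _ (by grind) ?_)
    rw [Finset.card_eq_succ]
    refine ⟨p, {r, s, t}, by grind, rfl, Finset.card_eq_three.2 ⟨r, s, t, h4, h5, h6, rfl⟩⟩
  obtain ⟨o, ho⟩ : S.Nonempty := Finset.card_pos.1 (by omega)
  have hcard := Finset.card_erase_of_mem ho
  obtain ⟨A, hAV, hA, hB, a, ha⟩ := exists_monochromatic_partition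
    (fun i j => c i j - c o i - c o j) (fun i j => by rw [hc i j]; ring) (S.erase o)
    (by
      intro i hi j hj k hk h1 h2 h3
      rcases hquad o ho i (by grind) j (by grind) k (by grind) (by grind) (by grind) (by grind)
        h1 h2 h3 with h | h | h
      · left; linear_combination -h
      · right; left; linear_combination -h
      · right; right; linear_combination -h)
    (by
      intro i hi j hj k hk l hl e1 e2 e3 e4 n1 n2 n3 n4 n5 n6
      rcases hquad i (by grind) j (by grind) k (by grind) l (by grind) n1 n2 n3 n4 n5 n6 with
        h | h | h
      · linear_combination e1 - h - e4
      · linear_combination h + e2 - e3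
      · refine mul_left_cancel₀ h2 ?_
        linear_combination h + e1 + e2 - e3 - e4)
    (by omega)
  have side : ∀ B ⊆ S.erase o, (S.erase o \ B).Nonempty → 2 ≤ B.card →
      (∀ i ∈ B, ∀ j ∈ S.erase o, j ∉ B → c i j - c o i - c o j = a) → False := by
    intro B hBV hB' hB2 hB
    obtain ⟨w, hw⟩ := hB'
    refine hS ⟨B, by grind, hB2, Finset.one_lt_card.2 ⟨o, by grind, w, by grind, by grind⟩, ?_⟩
    have hshift : ∀ i ∈ B, ∀ k ∈ S, k ∉ B → ∃ β, ∀ j ∈ B, c j k = c o j + β := by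
      intro i hi k hk hkB
      by_cases hko : k = o
      · subst hko
        exact ⟨0, fun j hj => by rw [hc j k, add_zero]⟩
      · exact ⟨a + c o k, fun j hj => by linear_combination hB j hj k (by grind) hkB⟩
    intro i hi j hj k hk hkB l hl hlB
    obtain ⟨β, hβ⟩ := hshift i hi k hk hkB
    obtain ⟨γ, hγ⟩ := hshift i hi l hl hlB
    rw [hβ i hi, hβ j hj, hγ i hi, hγ j hj]
    ring
  by_cases hA2 : 2 ≤ A.card
  · exact side A hAV hB hA2 ha
  · refine side (S.erase o \ A) Finset.sdiff_subset ?_ ?_ ?_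
    · obtain ⟨x, hx⟩ := hA
      exact ⟨x, by grind⟩
    · rw [Finset.card_sdiff_of_subset hAV]
      omega
    · intro i hi j hj hjB
      have := ha j (by grind) i (by grind) (by grind)
      rw [hc i j]
      linear_combination this

end Small

section Six

variable {ι K : Type*} [DecidableEq ι] [Field K] {c : ι → ι → K} {X : Finset ι}

theorem twin_of_decomposable_insert_quad (hc : ∀ i j, c i j = c j i) {p r s t w : ι}
    (h1 : p ≠ r) (h2 : p ≠ s) (h3 : p ≠ t) (h4 : r ≠ s)
    (h5 : r ≠ t) (h6 : s ≠ t) (hw : w ∉ ({p, r, s, t} : Finset ι))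
    (e1 : c p s + c r t ≠ c p t + c r s) (e2 : c p r + c s t ≠ c p t + c r s)
    (e3 : c p r + c s t ≠ c p s + c r t) (h : Decomposable c (insert w {p, r, s, t})) :
    (c w r - c p r = c w s - c p s ∧ c w r - c p r = c w t - c p t) ∨
    (c w p - c p r = c w s - c r s ∧ c w p - c p r = c w t - c r t) ∨
    (c w p - c p s = c w r - c r s ∧ c w p - c p s = c w t - c s t) ∨
    (c w p - c p t = c w r - c r t ∧ c w p - c p t = c w s - c s t) := by
  have hX : ¬ Decomposable c {p, r, s, t} := fun h => by
    rcases eq_of_decomposable_quad hc h with h | h | h <;> contradiction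
  simp only [Finset.mem_insert, Finset.mem_singleton, not_or] at hw
  obtain ⟨x, hx, α, hα⟩ := exists_twin_of_insert hc hX h
  simp only [Finset.mem_insert, Finset.mem_singleton] at hx hα
  have hp := hα p (by grind)
  have hr := hα r (by grind)
  have hs := hα s (by grind)
  have ht := hα t (by grind)
  clear hα h
  rcases hx with rfl | rfl | rfl | rfl
  · left; grind
  · right; left; grind
  · right; right; left; grind
  · right; right; right; grind

/-- If an indecomposable set with six elements contains an indecomposable set with four
elements, then it also contains one with five. -/
theorem exists_indecomposable_card_five (hc : ∀ i j, c i j = c j i) (hX : ¬ Decomposable c X)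
    (hcard : X.card = 4) {u v : ι} (hu : u ∉ X) (hv : v ∉ X) (huv : u ≠ v)
    (hS : ¬ Decomposable c (insert u (insert v X))) :
    ∃ Y ⊆ insert u (insert v X), Y.card = 5 ∧ ¬ Decomposable c Y := by
  by_contra! H
  have hcS : (insert u (insert v X)).card = 6 := by
    rw [Finset.card_insert_of_notMem (by grind), Finset.card_insert_of_notMem hv, hcard]
  obtain ⟨x, hx, htu⟩ := exists_twin_of_insert hc hX
    (H (insert u X) (by grind) (by rw [Finset.card_insert_of_notMem hu, hcard]))
  obtain ⟨y, hy, htv⟩ := exists_twin_of_insert hc hX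
    (H (insert v X) (by grind) (by rw [Finset.card_insert_of_notMem hv, hcard]))
  obtain ⟨α, hα⟩ := htu
  obtain ⟨β, hβ⟩ := htv
  have hxy : x ≠ y := by
    rintro rfl
    have hsub : ({x, u, v} : Finset ι) ⊆ insert u (insert v X) := by grind
    have hc3 : ({x, u, v} : Finset ι).card = 3 :=
      Finset.card_eq_three.2 ⟨x, u, v, by grind, by grind, huv, rfl⟩
    refine hS ⟨{x, u, v}, hsub, by omega, ?_, isCut_of_shift x fun i hi => ?_⟩
    · rw [Finset.card_sdiff_of_subset hsub]; omega
    · simp only [Finset.mem_insert, Finset.mem_singleton] at hi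
      rcases hi with rfl | rfl | rfl
      · exact ⟨0, by simp⟩
      · exact ⟨α, fun k hk hk' => hα k (by grind) (by grind) (by grind)⟩
      · exact ⟨β, fun k hk hk' => hβ k (by grind) (by grind) (by grind)⟩
  have hrest : ((X.erase x).erase y).card = 2 := by
    rw [Finset.card_erase_of_mem (by grind), Finset.card_erase_of_mem hx, hcard]
  obtain ⟨o, z, hoz, hrest⟩ := Finset.card_eq_two.1 hrest
  have hXeq : X = {o, x, y, z} := by grind
  have hox : o ≠ x := by grind
  have hoy : o ≠ y := by grind
  have hzx : z ≠ x := by grind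
  have hzy : z ≠ y := by grind
  have hF : c u v ≠ c x y + α + β := by
    intro hF
    refine hS (decomposable_of_twin (x := x) (u := u) (by omega) (by grind) (by grind)
      (by grind) ⟨α, fun k hk hkx hku => ?_⟩)
    rcases Finset.mem_insert.1 hk with rfl | hk
    · exact absurd rfl hku
    rcases Finset.mem_insert.1 hk with rfl | hk
    · rw [hF, hc x k, hβ x hx hxy (by grind), hc x y]
      ring
    · exact hα k hk hkx hku
  have hX1 : c o y + c x z ≠ c o z + c x y := fun e =>
    hX (hXeq ▸ decomposable_quad hox hoy hoz hxy hzx.symm hzy.symm e)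
  have hX2 : c o x + c y z ≠ c o z + c x y := fun e => by
    refine hX (?_ : Decomposable c X)
    rw [hXeq, Finset.insert_comm x y]
    exact decomposable_quad hoy hox hoz hxy.symm hzy.symm hzx.symm (by rw [e, hc y x])
  have hX3 : c o x + c y z ≠ c o y + c x z := fun e => by
    refine hX (?_ : Decomposable c X)
    have : X = {o, z, y, x} := by grind
    rw [this]
    exact decomposable_quad hoz hoy hox hzy hzx hxy.symm (by rw [hc z x, hc z y]; exact e.symm)
  have hou : o ≠ u := by grind
  have hov : o ≠ v := by grind
  have hxu : x ≠ u := by grind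
  have hxv : x ≠ v := by grind
  have hyu : y ≠ u := by grind
  have hyv : y ≠ v := by grind
  have hzu : z ≠ u := by grind
  have hzv : z ≠ v := by grind
  have ho : o ∈ X := by grind
  have hz : z ∈ X := by grind
  have huo : c o u = c o x + α := by rw [hc o u, hc o x, hα o ho hox hou]
  have huy : c y u = c x y + α := by rw [hc y u, hα y hy hxy.symm hyu]
  have huz : c z u = c x z + α := by rw [hc z u, hα z hz hzx hzu]
  have hvo : c o v = c o y + β := by rw [hc o v, hc o y, hβ o ho hoy hov]
  have hvx : c x v = c x y + β := by rw [hc x v, hc x y, hβ x hx hxy hxv]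
  have hvz : c z v = c y z + β := by rw [hc z v, hc y z, hβ z hz hzy hzv, hc y z]
  have five : ∀ w p r s t : ι, p ≠ r → p ≠ s → p ≠ t → r ≠ s → r ≠ t → s ≠ t →
      w ∉ ({p, r, s, t} : Finset ι) → insert w {p, r, s, t} ⊆ insert u (insert v X) →
      Decomposable c (insert w {p, r, s, t}) := by
    intro w p r s t h1 h2 h3 h4 h5 h6 hw hsub
    refine H _ hsub ?_
    rw [Finset.card_insert_of_notMem hw, Finset.card_insert_of_notMem (by grind),
      Finset.card_eq_three.2 ⟨r, s, t, h4, h5, h6, rfl⟩]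
  have D1 := twin_of_decomposable_insert_quad hc (p := o) (r := u) (s := y) (t := z) (w := v)
    hou hoy hoz hyu.symm hzu.symm hzy.symm (by grind)
    (by rw [hc u z, hc u y, huz, huy]; exact fun e => hX1 (by linear_combination e))
    (by rw [hc u y, huo, huy]; exact fun e => hX2 (by linear_combination e))
    (by rw [hc u z, huo, huz]; exact fun e => hX3 (by linear_combination e))
    (five v o u y z hou hoy hoz hyu.symm hzu.symm hzy.symm (by grind) (by grind))
  have D2 := twin_of_decomposable_insert_quad hc (p := o) (r := v) (s := x) (t := z) (w := u)
    hov hox hoz hxv.symm hzv.symm hzx.symm (by grind)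
    (by rw [hc v z, hc v x, hvz, hvx]; exact fun e => hX2 (by linear_combination e))
    (by rw [hc v x, hvo, hvx]; exact fun e => hX1 (by linear_combination e))
    (by rw [hc v z, hvo, hvz]; exact fun e => hX3 (by linear_combination -e))
    (five u o v x z hov hox hoz hxv.symm hzv.symm hzx.symm (by grind) (by grind))
  rw [hc v u, hc v o, hc v y, hc v z, hc u y, hc u z, hvo, huo, huy, huz, hvz] at D1
  rw [hc u o, hc u x, hc u z, hc v x, hc v z, hvo, huo, huz, hvx, hvz] at D2
  have hE : c y v - c o y - β = c y z - c o z := by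
    clear D2 five
    rcases D1 with D | D | D | D <;> grind
  have hD : c x u - c o x - α = c x z - c o z := by
    clear D1 five
    rcases D2 with D | D | D | D <;> grind
  have hFF : c u v - α - β = c x z + c o y - c o z ∨ c u v - α - β = c y z + c o x - c o z := by
    clear D2 five
    rcases D1 with D | D | D | D <;> grind
  rcases hFF with hF' | hF'
  · have D3 := twin_of_decomposable_insert_quad hc (p := o) (r := y) (s := u) (t := v) (w := x)
      hoy hou hov hyu hyv huv (by grind)
      (by clear five D1 D2; grind) (by clear five D1 D2; grind) (by clear five D1 D2; grind)
      (five x o y u v hoy hou hov hyu hyv huv (by grind) (by grind))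
    clear five D1 D2
    rcases D3 with D | D | D | D <;> grind
  · have D3 := twin_of_decomposable_insert_quad hc (p := o) (r := x) (s := u) (t := v) (w := y)
      hox hou hov hxu hxv huv (by grind)
      (by clear five D1 D2; grind) (by clear five D1 D2; grind) (by clear five D1 D2; grind)
      (five y o x u v hox hou hov hxu hxv huv (by grind) (by grind))
    clear five D1 D2
    rcases D3 with D | D | D | D <;> grind

end Six

section Quadratic

variable {ι K : Type*} [Field K]

theorem MvPolynomial.exists_bilinear_of_totalDegree_le_two (ρ : MvPolynomial ι K)
    (hρ : ρ.totalDegree ≤ 2) :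
    ∃ (B : (ι → K) →ₗ[K] (ι → K) →ₗ[K] K) (L : (ι → K) →ₗ[K] K) (C : K),
      ∀ x, MvPolynomial.eval x ρ = B x x + L x + C := by
  classical
  have hmon : ∀ s : ι →₀ ℕ, s.sum (fun _ e => e) ≤ 2 → ∀ a : K,
      ∃ (B : (ι → K) →ₗ[K] (ι → K) →ₗ[K] K) (L : (ι → K) →ₗ[K] K) (C : K),
        ∀ x, MvPolynomial.eval x (MvPolynomial.monomial s a) = B x x + L x + C := by
    intro s hs a
    have hpeel : ∀ t : ι →₀ ℕ, t ≠ 0 → ∃ (i : ι) (t' : ι →₀ ℕ), t = Finsupp.single i 1 + t' := by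
      intro t ht
      obtain ⟨i, hi⟩ := Finsupp.ne_iff.1 ht
      refine ⟨i, t - Finsupp.single i 1, ?_⟩
      rw [add_tsub_cancel_of_le]
      rw [Finsupp.single_le_iff]
      exact Nat.one_le_iff_ne_zero.2 hi
    have hdeg : ∀ t : ι →₀ ℕ, t.sum (fun _ e => e) = t.degree := fun t => rfl
    rw [hdeg] at hs
    by_cases h0 : s = 0
    · subst h0
      exact ⟨0, 0, a, fun x => by simp⟩
    obtain ⟨i, s', rfl⟩ := hpeel s h0
    by_cases h1 : s' = 0
    · subst h1
      exact ⟨0, a • LinearMap.proj i, 0, fun x => by simp [MvPolynomial.eval_monomial]⟩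
    obtain ⟨j, s'', rfl⟩ := hpeel s' h1
    have h2 : s'' = 0 := by
      simp only [map_add, Finsupp.degree_single] at hs
      exact (Finsupp.degree_eq_zero_iff s'').1 (by omega)
    subst h2
    refine ⟨a • (LinearMap.mul K K).compl₁₂ (LinearMap.proj i) (LinearMap.proj j), 0, 0,
      fun x => ?_⟩
    simp [MvPolynomial.eval_monomial, Finsupp.prod_add_index', pow_add]
  have hsum : ∀ T : Finset (ι →₀ ℕ), T ⊆ ρ.support →
      ∃ (B : (ι → K) →ₗ[K] (ι → K) →ₗ[K] K) (L : (ι → K) →ₗ[K] K) (C : K),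
        ∀ x, MvPolynomial.eval x (∑ s ∈ T, MvPolynomial.monomial s (ρ.coeff s))
          = B x x + L x + C := by
    intro T
    induction T using Finset.induction_on with
    | empty => exact fun _ => ⟨0, 0, 0, fun x => by simp⟩
    | insert s T hs ih =>
      intro hT
      obtain ⟨B, L, C, h⟩ := ih ((Finset.subset_insert s T).trans hT)
      obtain ⟨B', L', C', h'⟩ := hmon s
        ((MvPolynomial.le_totalDegree (hT (Finset.mem_insert_self s T))).trans hρ) (ρ.coeff s)
      refine ⟨B' + B, L' + L, C' + C, fun x => ?_⟩
      rw [Finset.sum_insert hs, map_add, h, h']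
      simp only [LinearMap.add_apply]
      ring
  obtain ⟨B, L, C, h⟩ := hsum ρ.support subset_rfl
  exact ⟨B, L, C, fun x => by rw [← h x, ← MvPolynomial.as_sum]⟩

/-- The symmetric weights given by the mixed coefficients of the quadratic form of `B`. -/
def mixedWeight [DecidableEq ι] (B : (ι → K) →ₗ[K] (ι → K) →ₗ[K] K) (i j : ι) : K :=
  B (Pi.single i 1) (Pi.single j 1) + B (Pi.single j 1) (Pi.single i 1)

theorem mixedWeight_comm [DecidableEq ι] (B : (ι → K) →ₗ[K] (ι → K) →ₗ[K] K) (i j : ι) :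
    mixedWeight B i j = mixedWeight B j i := add_comm _ _

theorem polar_single_sub [DecidableEq ι] (B : (ι → K) →ₗ[K] (ι → K) →ₗ[K] K) (i j k l : ι) :
    B (Pi.single i 1 - Pi.single j 1) (Pi.single k 1 - Pi.single l 1) +
      B (Pi.single k 1 - Pi.single l 1) (Pi.single i 1 - Pi.single j 1) =
    mixedWeight B i k + mixedWeight B j l - (mixedWeight B i l + mixedWeight B j k) := by
  simp only [mixedWeight, map_sub, LinearMap.sub_apply]
  ring

theorem second_difference_of_bilinear {F : (ι → K) → K} {B : (ι → K) →ₗ[K] (ι → K) →ₗ[K] K}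
    {L : (ι → K) →ₗ[K] K} {C : K} (hF : ∀ x, F x = B x x + L x + C) (x u v : ι → K) :
    F (x + u + v) + F x - (F (x + u) + F (x + v)) = B u v + B v u := by
  simp only [hF, map_add, LinearMap.add_apply]
  ring

end Quadratic

theorem PFunWSep.second_difference {q m : ℕ} {c : ZMod q} {G : (Fin m → ZMod q) → ZMod q}
    {W : Set (Fin m)} (h : PFunWSep c G W) {y u v : Fin m → ZMod q} (hy : ∑ i, y i = c)
    (hu : ∑ i, u i = 0) (hv : ∑ i, v i = 0) (huW : ∀ i ∉ W, u i = 0) (hvW : ∀ i ∈ W, v i = 0) :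
    G (y + u + v) + G y - (G (y + u) + G (y + v)) = 0 := by
  obtain ⟨f, g, hfg⟩ := h
  have hv' : ∀ z : Fin m → ZMod q, (fun i : W => (z + v) i) = fun i : W => z i := by
    intro z; ext i; simp [hvW i i.2]
  have hu' : ∀ z : Fin m → ZMod q, (fun i : ↥Wᶜ => (z + u) i) = fun i : ↥Wᶜ => z i := by
    intro z; ext i; simp [huW i i.2]
  rw [hfg (y + u + v) (by simp [Finset.sum_add_distrib, hy, hu, hv]), hfg y hy,
    hfg (y + u) (by simp [Finset.sum_add_distrib, hy, hu]),
    hfg (y + v) (by simp [Finset.sum_add_distrib, hy, hv]),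
    hv' (y + u), hv' y, hu' y, add_right_comm y u v, hu' (y + v)]
  ring

theorem decomposable_of_separable_subfunction {q n : ℕ} [Fact q.Prime] {a b : ZMod q}
    {F : (Fin (n + 1) → ZMod q) → ZMod q}
    {B : (Fin (n + 1) → ZMod q) →ₗ[ZMod q] (Fin (n + 1) → ZMod q) →ₗ[ZMod q] ZMod q}
    {L : (Fin (n + 1) → ZMod q) →ₗ[ZMod q] ZMod q} {C : ZMod q}
    (hF : ∀ x, F x = B x x + L x + C) (p : Fin (n + 1)) (hn : 2 ≤ n)
    (h : PFunSeparable (a - b) fun y : Fin n → ZMod q => F (p.insertNth b y)) :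
    Decomposable (mixedWeight B) (Finset.univ.erase p) := by
  classical
  obtain ⟨W, h2, hW, hsep⟩ := h
  have hcard : (W.toFinset.map p.succAboveEmb).card = W.ncard := by
    rw [Finset.card_map, Set.ncard_eq_toFinset_card']
  have hsub : W.toFinset.map p.succAboveEmb ⊆ Finset.univ.erase p := by
    intro i hi
    simp only [Finset.mem_map] at hi
    obtain ⟨j, -, rfl⟩ := hi
    simp
  refine ⟨W.toFinset.map p.succAboveEmb, hsub, by omega, ?_, ?_⟩
  · rw [Finset.card_sdiff_of_subset hsub, Finset.card_erase_of_mem (Finset.mem_univ p),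
      Finset.card_univ, Fintype.card_fin]
    omega
  intro i hi j hj k hk hkW l hl hlW
  have hex : ∀ k ∈ Finset.univ.erase p, k ∉ W.toFinset.map p.succAboveEmb →
      ∃ k', k' ∉ W ∧ p.succAbove k' = k := by
    intro k hk hkW
    obtain ⟨k', rfl⟩ := Fin.exists_succAbove_eq (Finset.ne_of_mem_erase hk)
    exact ⟨k', fun hk' => hkW (Finset.mem_map.2 ⟨k', by simpa using hk', rfl⟩), rfl⟩
  obtain ⟨k, hk₁, rfl⟩ := hex k hk hkW
  obtain ⟨l, hl₁, rfl⟩ := hex l hl hlW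
  obtain ⟨i, hiW, rfl⟩ := Finset.mem_map.1 hi
  obtain ⟨j, hjW, rfl⟩ := Finset.mem_map.1 hj
  rw [Set.mem_toFinset] at hiW hjW
  have hsingle : ∀ i : Fin n, p.insertNth (α := fun _ => ZMod q) 0 (Pi.single i 1) =
      (Pi.single (p.succAbove i) 1 : Fin (n + 1) → ZMod q) := by
    intro i
    rw [Fin.insertNth_eq_iff]
    refine ⟨by simp, ?_⟩
    ext t
    simp [Fin.removeNth, Pi.single_apply]
  have hadd : ∀ (y : Fin n → ZMod q) (i j : Fin n),
      p.insertNth (α := fun _ => ZMod q) b (y + (Pi.single i 1 - Pi.single j 1)) =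
      p.insertNth (α := fun _ => ZMod q) b y +
        (Pi.single (p.succAbove i) 1 - Pi.single (p.succAbove j) 1) := by
    intro y i j
    rw [← hsingle, ← hsingle, ← Fin.insertNth_sub, ← Fin.insertNth_add]
    simp
  have key := hsep.second_difference (y := Pi.single i (a - b))
    (u := Pi.single i 1 - Pi.single j 1) (v := Pi.single k 1 - Pi.single l 1)
    (by simp) (by simp) (by simp)
    (fun t ht => by
      have : t ≠ i := fun h => ht (h ▸ hiW)
      have : t ≠ j := fun h => ht (h ▸ hjW)
      simp [*])
    (fun t ht => by
      have : t ≠ k := fun h => hk₁ (h ▸ ht)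
      have : t ≠ l := fun h => hl₁ (h ▸ ht)
      simp [*])
  simp only [hadd] at key
  rw [second_difference_of_bilinear hF, polar_single_sub] at key
  exact sub_eq_zero.1 key

theorem separable_of_decomposable {q m : ℕ} [Fact q.Prime] (a : ZMod q)
    {F : (Fin m → ZMod q) → ZMod q}
    {B : (Fin m → ZMod q) →ₗ[ZMod q] (Fin m → ZMod q) →ₗ[ZMod q] ZMod q}
    {L : (Fin m → ZMod q) →ₗ[ZMod q] ZMod q} {C : ZMod q}
    (hF : ∀ x, F x = B x x + L x + C) (h : Decomposable (mixedWeight B) Finset.univ) :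
    PFunSeparable a F := by
  classical
  obtain ⟨W, -, h2, h2', hcut⟩ := h
  obtain ⟨i₀, hi₀⟩ : W.Nonempty := Finset.card_pos.1 (by omega)
  obtain ⟨k₀, hk₀⟩ : (Finset.univ \ W).Nonempty := Finset.card_pos.1 (by omega)
  have hk₀W : k₀ ∉ W := (Finset.mem_sdiff.1 hk₀).2
  rw [Finset.card_sdiff_of_subset (Finset.subset_univ W), Finset.card_univ, Fintype.card_fin] at h2'
  set i₁ : Fin m → ZMod q := Pi.single i₀ 1 with hi₁
  set k₁ : Fin m → ZMod q := Pi.single k₀ 1 with hk₁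
  set E : (↥(W : Set (Fin m)) → ZMod q) → Fin m → ZMod q :=
    fun y i => if hi : i ∈ (W : Set (Fin m)) then y ⟨i, hi⟩ else 0 with hE
  set E' : (↥((W : Set (Fin m))ᶜ) → ZMod q) → Fin m → ZMod q :=
    fun y i => if hi : i ∈ ((W : Set (Fin m))ᶜ : Set (Fin m)) then y ⟨i, hi⟩ else 0 with hE'
  refine ⟨W, by rwa [Set.ncard_coe_finset], by rw [Set.ncard_coe_finset]; omega,
    fun y => F (E y + (a - ∑ i, E y i) • k₁),
    fun y => F (E' y + (a - ∑ i, E' y i) • i₁) -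
      F ((a - ∑ i, E' y i) • i₁ + (∑ i, E' y i) • k₁), fun x hx => ?_⟩
  have hw : E (fun i => x i) = ∑ i ∈ W, x i • (Pi.single i 1 : Fin m → ZMod q) := by
    ext t
    simp [hE, Finset.sum_apply, Pi.single_apply]
  have hu : E' (fun i => x i) = ∑ i ∈ Wᶜ, x i • (Pi.single i 1 : Fin m → ZMod q) := by
    ext t
    by_cases ht : t ∈ W <;> simp [hE', Finset.sum_apply, Pi.single_apply, ht]
  have hsw : ∑ i, E (fun i => x i) i = ∑ i ∈ W, x i := by
    simp_rw [hw, Finset.sum_apply]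
    rw [Finset.sum_comm]
    simp [← Finset.mul_sum]
  have hsu : ∑ i, E' (fun i => x i) i = ∑ i ∈ Wᶜ, x i := by
    simp_rw [hu, Finset.sum_apply]
    rw [Finset.sum_comm]
    simp [← Finset.mul_sum]
  have hsum : ∑ i ∈ W, x i + ∑ i ∈ Wᶜ, x i = a := by rw [Finset.sum_add_sum_compl, hx]
  have hxwu : x = E (fun i => x i) + E' (fun i => x i) := by
    ext t
    by_cases ht : t ∈ W <;> simp [hE, hE', ht]
  simp only []
  rw [hsw, hsu]
  set w := E fun i => x i
  set u := E' fun i => x i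
  set s := ∑ i ∈ W, x i
  set t := ∑ i ∈ Wᶜ, x i
  have hat : a - t = s := by linear_combination -hsum
  have has : a - s = t := by linear_combination -hsum
  have hU : w - s • i₁ = ∑ i ∈ W, x i • (Pi.single i 1 - i₁) := by
    simp only [smul_sub, Finset.sum_sub_distrib, hw, ← Finset.sum_smul]
    rfl
  have hV : u - t • k₁ = ∑ k ∈ Wᶜ, x k • (Pi.single k 1 - k₁) := by
    simp only [smul_sub, Finset.sum_sub_distrib, hu, ← Finset.sum_smul]
    rfl
  have hzero : B (w - s • i₁) (u - t • k₁) + B (u - t • k₁) (w - s • i₁) = 0 := by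
    rw [hU, hV]
    simp only [map_sum, LinearMap.sum_apply, map_smul, LinearMap.smul_apply, smul_eq_mul,
      Finset.mul_sum]
    rw [Finset.sum_comm, ← Finset.sum_add_distrib]
    refine Finset.sum_eq_zero fun i hi => ?_
    rw [← Finset.sum_add_distrib]
    refine Finset.sum_eq_zero fun k hk => ?_
    have h1 := polar_single_sub B i i₀ k k₀
    rw [hcut i hi i₀ hi₀ k (Finset.mem_univ _) (Finset.mem_compl.1 hk) k₀ (Finset.mem_univ _) hk₀W,
      sub_self] at h1
    linear_combination x i * x k * h1
  have h1 := second_difference_of_bilinear hF (s • i₁ + t • k₁) (w - s • i₁) (u - t • k₁)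
  have e1 : s • i₁ + t • k₁ + (w - s • i₁) + (u - t • k₁) = x := by rw [hxwu]; abel
  have e2 : s • i₁ + t • k₁ + (w - s • i₁) = w + t • k₁ := by abel
  have e3 : s • i₁ + t • k₁ + (u - t • k₁) = u + s • i₁ := by abel
  rw [e1, e2, e3, hzero] at h1
  rw [hat, has]
  linear_combination h1

/-- Let `q` be an odd prime and `n ≥ 4`. If every partial function of `n` arguments
obtained from a quadratic partial function `ᵃf` (given on `Ω_a` by a polynomial of total
degree at most `2`) by fixing one argument to a constant is separable, then `ᵃf` itself
is separable. -/
theorem pfun_separable_of_subfunctions {q n : ℕ} (hq : q.Prime) (hqodd : Odd q)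
    (hn : 4 ≤ n) (a : ZMod q)
    (ρ : MvPolynomial (Fin (n + 1)) (ZMod q)) (hρ : ρ.totalDegree ≤ 2)
    (h : ∀ (i : Fin (n + 1)) (b : ZMod q),
      PFunSeparable (a - b)
        (fun y : Fin n → ZMod q => MvPolynomial.eval (i.insertNth b y) ρ)) :
    PFunSeparable a (fun x => MvPolynomial.eval x ρ) := by
  have := Fact.mk hq
  have two_ne : (2 : ZMod q) ≠ 0 := fun h2 => by
    have h2' : q ∣ 2 := (ZMod.natCast_eq_zero_iff 2 q).1 (by exact_mod_cast h2)
    rw [(Nat.prime_dvd_prime_iff_eq hq Nat.prime_two).1 h2'] at hqodd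
    exact absurd hqodd (by decide)
  obtain ⟨B, L, C, hF⟩ := MvPolynomial.exists_bilinear_of_totalDegree_le_two ρ hρ
  refine separable_of_decomposable a (F := fun x => MvPolynomial.eval x ρ) hF ?_
  by_contra hS
  have hc := mixedWeight_comm B
  have hcard : (Finset.univ : Finset (Fin (n + 1))).card = n + 1 := by simp
  suffices ∃ Y ⊆ Finset.univ, Y.card + 1 = (Finset.univ : Finset (Fin (n + 1))).card ∧
      ¬ Decomposable (mixedWeight B) Y by
    obtain ⟨Y, -, hYcard, hYind⟩ := this
    obtain ⟨p, hp⟩ := Finset.card_eq_one.1 (show Yᶜ.card = 1 by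
      rw [Finset.card_compl, Fintype.card_fin]
      omega)
    obtain rfl : Y = Finset.univ.erase p := by
      rw [Finset.erase_eq, ← Finset.compl_eq_univ_sdiff, ← hp, compl_compl]
    exact hYind (decomposable_of_separable_subfunction
      (F := fun x => MvPolynomial.eval x ρ) hF p (by omega) (h p 0))
  obtain ⟨X, hXS, hX4, hX⟩ := exists_indecomposable_quad two_ne hc hS (by omega)
  obtain heven | hodd := Nat.even_or_odd (n + 1 - 4)
  · have hsd : (Finset.univ \ X).card = n + 1 - 4 := by
      rw [Finset.card_sdiff_of_subset hXS, hcard, hX4]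
    obtain ⟨u, hu, v, hv, huv, hXuv⟩ := exists_insert_insert hc hS hX hXS (by omega) (by
      obtain ⟨r, hr⟩ := heven
      omega)
    obtain ⟨Y, -, hY5, hY⟩ := exists_indecomposable_card_five hc hX hX4
      (Finset.mem_sdiff.1 hu).2 (Finset.mem_sdiff.1 hv).2 huv hXuv
    refine exists_card_succ hc hS hY (Finset.subset_univ Y) (by omega) ?_
    obtain ⟨r, hr⟩ := heven
    exact ⟨r - 1, by omega⟩
  · exact exists_card_succ hc hS hX hXS (by omega) (by rwa [hcard, hX4])
end

section
/- Let q be a prime, f : Z_q^n → Z_q, a ∈ Z_q, and let W ⊆ {1,…,n} with 2 ≤ |W| ≤ n − 1. Then the n-ary quasigroup Q_{f,a} is W-separable if and only if the 0-extension ⁰f of f is W-separable. -/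
/-- A (multi-ary) quasigroup operation on `S` with arguments indexed by `ι`: in the
equation `x₀ = Q x` the values of all but one of the variables `x₀, (x i)_{i : ι}`
uniquely determine the remaining one; equivalently, `Q` is bijective in each argument. -/
def IsNQuasigroup {ι S : Type*} [DecidableEq ι] (Q : (ι → S) → S) : Prop :=
  ∀ (i : ι) (x : ι → S),
    Function.Bijective fun t : S => Q (Function.update x i t)

/-- The `n`-ary quasigroup `Q_{f,a}` of order `q²` built from `f : (ZMod q)ⁿ → ZMod q`
and `a : ZMod q`. -/
def Qf {q n : ℕ} (f : (Fin n → ZMod q) → ZMod q) (a : ZMod q) :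
    (Fin n → ZMod q × ZMod q) → ZMod q × ZMod q :=
  fun z => (-(∑ i, (z i).1) + a, -(∑ i, (z i).2) + f fun i => (z i).1)

/-- An `n`-ary quasigroup `Q` is `W`-separable if `Q x̄ = G (x̄', H x̄'')`, where `H` is a
`|W|`-ary quasigroup applied to the arguments indexed by `W`, and `G` is an
`(n - |W| + 1)`-ary quasigroup applied to the remaining arguments together with the
value of `H`. -/
def QSep {S : Type*} {n : ℕ} (Q : (Fin n → S) → S) (W : Set (Fin n)) : Prop :=
  ∃ (H : (↥W → S) → S) (G : (↥Wᶜ ⊕ Unit → S) → S),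
    IsNQuasigroup H ∧ IsNQuasigroup G ∧
    ∀ x : Fin n → S,
      Q x = G (Sum.elim (fun u : ↥Wᶜ => x u) fun _ => H fun w : ↥W => x w)

/-- Coordinatewise addition on `A × A`, twisted in the second coordinate by a function of the
first coordinates, is a quasigroup operation. -/
theorem isNQuasigroup_sum_twist {ι A : Type*} [DecidableEq ι] [Fintype ι] [AddCommGroup A]
    (g : (ι → A) → A) :
    IsNQuasigroup fun z : ι → A × A =>
      (∑ i, (z i).1, ∑ i, (z i).2 + g fun i => (z i).1) := by
  intro i z
  have h_fst (t : A × A) : (fun j => (Function.update z i t j).1) =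
      Function.update (fun j => (z j).1) i t.1 := by
    ext j; by_cases hj : j = i <;> simp [hj]
  have h_snd (t : A × A) : (fun j => (Function.update z i t j).2) =
      Function.update (fun j => (z j).2) i t.2 := by
    ext j; by_cases hj : j = i <;> simp [hj]
  simp only [h_fst, h_snd, Finset.sum_update_of_mem (Finset.mem_univ i)]
  constructor
  · rintro ⟨t, u⟩ ⟨t', u'⟩ h
    obtain ⟨h1, h2⟩ := Prod.mk.inj h
    obtain rfl : t = t' := by simpa using h1
    have : u = u' := by simpa using h2
    rw [this]
  · rintro ⟨b, c⟩
    refine ⟨(b - ∑ j ∈ Finset.univ \ {i}, (z j).1,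
      c - g (Function.update (fun j => (z j).1) i (b - ∑ j ∈ Finset.univ \ {i}, (z j).1)) -
        ∑ j ∈ Finset.univ \ {i}, (z j).2), ?_⟩
    simp

theorem IsNQuasigroup.bijective_comp {ι S : Type*} [DecidableEq ι] {Q : (ι → S) → S}
    (hQ : IsNQuasigroup Q) {e : S → S} (he : Function.Bijective e) :
    IsNQuasigroup fun z => e (Q z) :=
  fun i z => he.comp (hQ i z)

/-- The tuple indexed by `ι` with prescribed restrictions to `W` and to its complement. -/
noncomputable def glueTuple {ι A : Type*} (W : Set ι) (w : ↥W → A) (u : ↥Wᶜ → A) : ι → A :=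
  open Classical in fun i => if h : i ∈ W then w ⟨i, h⟩ else u ⟨i, h⟩

section glueTuple

variable {ι A : Type*} {W : Set ι} (w : ↥W → A) (u : ↥Wᶜ → A)

theorem glueTuple_apply_mem (i : ↥W) : glueTuple W w u i = w i := by
  simp [glueTuple]

theorem glueTuple_apply_compl (i : ↥Wᶜ) : glueTuple W w u i = u i := by
  have h : (i : ι) ∉ W := i.2
  simp [glueTuple, h]

theorem glueTuple_restrict (x : ι → A) :
    glueTuple W (fun i => x i) (fun i => x i) = x := by
  ext i
  by_cases h : i ∈ W <;> simp [glueTuple, h]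

theorem sum_coe_add_sum_coe_compl [Fintype ι] [Fintype ↥W] [Fintype ↥Wᶜ] [AddCommMonoid A]
    (x : ι → A) : ∑ i : ↥W, x i + ∑ i : ↥Wᶜ, x i = ∑ i, x i := by
  classical
  rw [← Fintype.sum_subtype_add_sum_subtype (· ∈ W) x]
  congr!

theorem sum_glueTuple [Fintype ι] [Fintype ↥W] [Fintype ↥Wᶜ] [AddCommMonoid A] :
    ∑ i, glueTuple W w u i = ∑ i, w i + ∑ i, u i := by
  simp only [← sum_coe_add_sum_coe_compl (W := W) (glueTuple W w u), glueTuple_apply_mem,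
    glueTuple_apply_compl]

end glueTuple

/-- In a `W`-separable quasigroup, whether two `W`-parts give the same value does not depend on
the remaining arguments. -/
theorem QSep.eq_of_eq {S : Type*} {n : ℕ} {Q : (Fin n → S) → S} {W : Set (Fin n)}
    (hQ : QSep Q W) {w w' : ↥W → S} {u : ↥Wᶜ → S}
    (h : Q (glueTuple W w u) = Q (glueTuple W w' u)) (v : ↥Wᶜ → S) :
    Q (glueTuple W w v) = Q (glueTuple W w' v) := by
  obtain ⟨H, G, -, hG, hQ⟩ := hQ
  simp only [hQ, glueTuple_apply_mem, glueTuple_apply_compl] at h ⊢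
  suffices H w = H w' by rw [this]
  have h_update (t : S) : Function.update (Sum.elim u fun _ => H w) (Sum.inr ()) t =
      Sum.elim u fun _ => t := by
    ext (i | i) <;> simp
  refine (hG (Sum.inr ()) (Sum.elim u fun _ => H w)).injective ?_
  simpa only [h_update] using h

theorem Qf_glueTuple {q n : ℕ} (f : (Fin n → ZMod q) → ZMod q) (a : ZMod q) {W : Set (Fin n)}
    [Fintype ↥W] [Fintype ↥Wᶜ] (x y : ↥W → ZMod q) (u : ↥Wᶜ → ZMod q) :
    Qf f a (glueTuple W (fun i => (x i, y i)) fun i => (u i, 0)) =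
      (-(∑ i, x i + ∑ i, u i) + a, -∑ i, y i + f (glueTuple W x u)) := by
  have h_fst (i : Fin n) : (glueTuple W (fun i => (x i, y i)) (fun i => (u i, 0)) i).1 =
      glueTuple W x u i := by
    by_cases h : i ∈ W <;> simp [glueTuple, h]
  have h_snd (i : Fin n) : (glueTuple W (fun i => (x i, y i)) (fun i => (u i, 0)) i).2 =
      glueTuple W y 0 i := by
    by_cases h : i ∈ W <;> simp [glueTuple, h]
  simp [Qf, h_fst, h_snd, sum_glueTuple]

/-- If `Qf f a` is `W`-separable, then the increments of `f` between two `W`-parts with the same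
sum do not depend on the remaining arguments. -/
theorem QSep.sub_eq_sub {q n : ℕ} {f : (Fin n → ZMod q) → ZMod q} {a : ZMod q}
    {W : Set (Fin n)} [Fintype ↥W] (hQ : QSep (Qf f a) W) (i₀ : ↥W) {x x' : ↥W → ZMod q}
    (hx : ∑ i, x i = ∑ i, x' i) (u v : ↥Wᶜ → ZMod q) :
    f (glueTuple W x u) - f (glueTuple W x' u) = f (glueTuple W x v) - f (glueTuple W x' v) := by
  classical
  have h : Qf f a (glueTuple W
        (fun i => (x i, (Pi.single i₀ (f (glueTuple W x v)) : ↥W → ZMod q) i))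
        fun i => (v i, 0)) =
      Qf f a (glueTuple W
        (fun i => (x' i, (Pi.single i₀ (f (glueTuple W x' v)) : ↥W → ZMod q) i))
        fun i => (v i, 0)) := by
    simp [Qf_glueTuple, hx]
  have h' := congrArg Prod.snd (hQ.eq_of_eq h fun i => (u i, 0))
  simp only [Qf_glueTuple, Finset.sum_pi_single', Finset.mem_univ, if_true]
    at h'
  linear_combination h'

/-- The `n`-ary quasigroup `Q_{f,a}` is `W`-separable if and only if the `0`-extension
`⁰f` of `f` is `W`-separable as a partial function on `Ω₀` (the extra argument `x₀`,
the last coordinate, belongs to the complement of `W`). -/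
theorem qf_sep_iff_extension_sep {q n : ℕ} (hq : q.Prime)
    (f : (Fin n → ZMod q) → ZMod q) (a : ZMod q)
    (W : Set (Fin n)) (hW1 : 2 ≤ W.ncard) (hW2 : W.ncard ≤ n - 1) :
    QSep (Qf f a) W ↔
      ∃ (f' : (↥W → ZMod q) → ZMod q)
        (f'' : ((↥Wᶜ → ZMod q) × ZMod q) → ZMod q),
        ∀ (x : Fin n → ZMod q) (x0 : ZMod q), (∑ i, x i) + x0 = 0 →
          f x = f' (fun i => x i) + f'' ((fun i => x i), x0) := by
  classical
  constructor
  · intro hQ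
    obtain ⟨i₀, hi₀⟩ := Set.nonempty_of_ncard_ne_zero (by omega : W.ncard ≠ 0)
    let s (c : ZMod q) : ↥W → ZMod q := Pi.single ⟨i₀, hi₀⟩ c
    refine ⟨fun w => f (glueTuple W w 0), fun p =>
      f (glueTuple W (s (-p.2 - ∑ i, p.1 i)) p.1) - f (glueTuple W (s (-p.2 - ∑ i, p.1 i)) 0),
      fun x x0 hx => ?_⟩
    have h_sum : ∑ i : ↥W, x i = ∑ i, s (-x0 - ∑ i : ↥Wᶜ, x i) i := by
      rw [Fintype.sum_pi_single']
      rw [← sum_coe_add_sum_coe_compl (W := W)] at hx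
      linear_combination hx
    have h := hQ.sub_eq_sub ⟨i₀, hi₀⟩ h_sum (fun i => x i) 0
    rw [glueTuple_restrict] at h
    linear_combination h
  · rintro ⟨f', f'', hf⟩
    have he : Function.Bijective fun p : ZMod q × ZMod q => (-p.1 + a, -p.2) :=
      Function.Bijective.prodMap ((Equiv.addRight a).bijective.comp (Equiv.neg _).bijective)
        (Equiv.neg _).bijective
    refine ⟨_, _, isNQuasigroup_sum_twist fun w => -f' w,
      (isNQuasigroup_sum_twist fun t : ↥Wᶜ ⊕ Unit → ZMod q =>
        -f'' (fun i => t (Sum.inl i), -∑ i, t i)).bijective_comp he, fun z => ?_⟩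
    have h_fst := sum_coe_add_sum_coe_compl (W := W) fun i => (z i).1
    have h_snd := sum_coe_add_sum_coe_compl (W := W) fun i => (z i).2
    simp only [Qf, Fintype.sum_sum_type, Sum.elim_inl, Sum.elim_inr, Finset.univ_unique,
      Finset.sum_singleton]
    rw [hf _ _ (add_neg_cancel _), ← h_fst, ← h_snd, add_comm (∑ i : ↥Wᶜ, (z i).1)]
    ext
    · rfl
    · simp only
      ring
end

section
/- Let q be a prime, a ∈ Z_q, 1 ≤ i ≤ n, and let f, g : Z_q^n → Z_q satisfy ᵃf(x_1,…,x_{i−1},x_i,x_{i+1},…,x_n,x_0) = ᵃg(x_1,…,x_{i−1},x_0,x_{i+1},…,x_n,x_i) for every point (x_1,…,x_n,x_0) ∈ Ω_a. Then the n-ary quasigroups Q_{f,a} and Q_{g,a} are inverses of each other in the i-th place: Q_{f,a}^{(i)} = Q_{g,a}; that is, for all z_1,…,z_n, z_0 ∈ Σ, z_0 = Q_{f,a}(z_1,…,z_n) holds if and only if z_i = Q_{g,a}(z_1,…,z_{i−1},z_0,z_{i+1},…,z_n). -/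
theorem Fintype.sum_update_eq_sub_add {ι M : Type*} [Fintype ι] [DecidableEq ι] [AddCommGroup M]
    (x : ι → M) (i : ι) (c : M) :
    ∑ j, Function.update x i c j = ∑ j, x j - x i + c := by
  rw [Finset.sum_update_of_mem (Finset.mem_univ i), Finset.sdiff_singleton_eq_erase,
    Finset.sum_erase_eq_sub (Finset.mem_univ i), add_comm]

theorem Qf_update {q n : ℕ} (f : (Fin n → ZMod q) → ZMod q) (a : ZMod q) (i : Fin n)
    (z : Fin n → ZMod q × ZMod q) (w : ZMod q × ZMod q) :
    Qf f a (Function.update z i w) =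
      (-(∑ j, (z j).1 - (z i).1 + w.1) + a,
        -(∑ j, (z j).2 - (z i).2 + w.2) + f (Function.update (fun j => (z j).1) i w.1)) := by
  have h1 : (fun j => (Function.update z i w j).1) = Function.update (fun j => (z j).1) i w.1 :=
    Function.comp_update Prod.fst z i w
  have h2 : (fun j => (Function.update z i w j).2) = Function.update (fun j => (z j).2) i w.2 :=
    Function.comp_update Prod.snd z i w
  simp only [Qf, h1, h2, Fintype.sum_update_eq_sub_add]

/-- If `ᵃf(x₁,…,xᵢ,…,x_n,x₀) = ᵃg(x₁,…,x_{i-1},x₀,x_{i+1},…,x_n,xᵢ)` at every point of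
`Ω_a`, then the `n`-ary quasigroups `Q_{f,a}` and `Q_{g,a}` are inverses of each other in
the `i`-th place: `z₀ = Q_{f,a}(z)` holds iff `zᵢ = Q_{g,a}(z with z₀ in place i)`. -/
theorem qf_inverse_of_swap {q n : ℕ} (hq : q.Prime) (a : ZMod q) (i : Fin n)
    (f g : (Fin n → ZMod q) → ZMod q)
    (hfg : ∀ (x : Fin n → ZMod q) (x0 : ZMod q), (∑ j, x j) + x0 = a →
      f x = g (Function.update x i x0)) :
    ∀ (z : Fin n → ZMod q × ZMod q) (z0 : ZMod q × ZMod q),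
      z0 = Qf f a z ↔ z i = Qf g a (Function.update z i z0) := by
  intro z w
  rw [Qf_update, Prod.ext_iff, Prod.ext_iff]
  simp only [Qf]
  constructor
  · rintro ⟨h1, h2⟩
    have hf := hfg (fun j => (z j).1) w.1 (by rw [h1]; ring)
    exact ⟨by linear_combination h1, by linear_combination h2 + hf⟩
  · rintro ⟨h1, h2⟩
    have hf := hfg (fun j => (z j).1) w.1 (by linear_combination h1)
    exact ⟨by linear_combination h1, by linear_combination h2 - hf⟩
end

section
/- Let q > 2 be a prime, n ≥ 4, a ∈ Z_q, and let f : Z_q^n → Z_q be a quadratic function (the evaluation of a polynomial over Z_q of total degree at most 2). If every (n−1)-ary retract of the n-ary quasigroup Q_{f,a} of order q² is separable — that is, for every i ∈ {1,…,n}, every j, and every constant z ∈ Σ, the (n−1)-ary quasigroup obtained from Q_{f,a} or from one of its inverses Q_{f,a}^{(j)} by substituting z for the i-th argument is separable — then Q_{f,a} itself is separable. -/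
/-- `Q'` is the inverse of the quasigroup `Q` in the `j`-th place:
`x₀ = Q x` iff `x j = Q' (x with x₀ in place j)`. -/
def IsInvAt {S : Type*} {n : ℕ} (Q Q' : (Fin n → S) → S) (j : Fin n) : Prop :=
  ∀ (x : Fin n → S) (x0 : S), x0 = Q x ↔ x j = Q' (Function.update x j x0)

/-- An `n`-ary quasigroup `Q` is separable if `Q` or one of its inverses is `W`-separable
for some `W` with `2 ≤ |W| ≤ n - 1`. -/
def QSeparable {S : Type*} {n : ℕ} (Q : (Fin n → S) → S) : Prop :=
  ∃ W : Set (Fin n), 2 ≤ W.ncard ∧ W.ncard ≤ n - 1 ∧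
    (QSep Q W ∨ ∃ (j : Fin n) (Q' : (Fin n → S) → S), IsInvAt Q Q' j ∧ QSep Q' W)

section Splits

variable {V F : Type*} [DecidableEq V] [Field F]

/-- `(A, X \ A)` is a split of the weighted complete graph `w` on `X`: both sides have at least
two vertices, and the weights across are of the form `α a + β b`. -/
def IsSplit (w : V → V → F) (X A : Finset V) : Prop :=
  A ⊆ X ∧ 2 ≤ A.card ∧ 2 ≤ (X \ A).card ∧
    ∀ a ∈ A, ∀ a' ∈ A, ∀ b ∈ X \ A, ∀ b' ∈ X \ A, w a b + w a' b' = w a b' + w a' b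

/-- The weighted complete graph `w` on `X` has no split. -/
def SplitFree (w : V → V → F) (X : Finset V) : Prop :=
  ∀ A, ¬ IsSplit w X A

/-- `x` has the same weights as `u` to the vertices of `X` other than `u`, up to the
constant `k`. -/
def IsTwin (w : V → V → F) (X : Finset V) (x u : V) (k : F) : Prop :=
  ∀ z ∈ X, z ≠ u → w x z = w u z + k

variable {w : V → V → F}

lemma IsSplit.compl (hw : ∀ a b, w a b = w b a) {X A : Finset V} (h : IsSplit w X A) :
    IsSplit w X (X \ A) := by
  obtain ⟨h1, h2, h3, h4⟩ := h
  have hXA : X \ (X \ A) = A := by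
    exact Finset.sdiff_sdiff_eq_self h1
  refine ⟨Finset.sdiff_subset, h3, by rwa [hXA], ?_⟩
  rw [hXA]
  intro a ha a' ha' b hb b' hb'
  have := h4 b hb b' hb' a ha a' ha'
  rw [hw a b, hw a' b', hw a b', hw a' b]
  linear_combination this

/-- A split of a set restricts to a split of a subset meeting both sides in at least two
vertices. -/
lemma IsSplit.restrict {X Y A : Finset V} (h : IsSplit w Y A) (hXY : X ⊆ Y)
    (h1 : 2 ≤ (A ∩ X).card) (h2 : 2 ≤ (X \ A).card) : IsSplit w X (A ∩ X) := by
  refine ⟨Finset.inter_subset_right, h1, ?_, ?_⟩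
  · rwa [Finset.sdiff_inter_self_right]
  · rw [Finset.sdiff_inter_self_right]
    intro a ha a' ha' b hb b' hb'
    simp only [Finset.mem_inter, Finset.mem_sdiff] at ha ha' hb hb'
    exact h.2.2.2 a ha.1 a' ha'.1 b (Finset.mem_sdiff.2 ⟨hXY hb.1, hb.2⟩) b'
      (Finset.mem_sdiff.2 ⟨hXY hb'.1, hb'.2⟩)

/-- A set with at least four vertices and two twins has a split. -/
lemma SplitFree.not_twins {X : Finset V} (h : SplitFree w X) (hX : 4 ≤ X.card)
    {u v : V} (hu : u ∈ X) (hv : v ∈ X) (huv : u ≠ v) (k : F) :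
    ¬ ∀ z ∈ X, z ≠ u → z ≠ v → w u z = w v z + k := by
  intro hk
  have hsub : ({u, v} : Finset V) ⊆ X := by
    intro z hz; simp at hz; rcases hz with rfl | rfl <;> assumption
  have hc : ({u, v} : Finset V).card = 2 := Finset.card_pair huv
  refine h {u, v} ⟨hsub, hc.ge, ?_, ?_⟩
  · rw [Finset.card_sdiff_of_subset hsub]; omega
  · intro a ha a' ha' b hb b' hb'
    simp only [Finset.mem_insert, Finset.mem_singleton, Finset.mem_sdiff, not_or] at ha ha' hb hb'
    have e1 := hk b hb.1 hb.2.1 hb.2.2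
    have e2 := hk b' hb'.1 hb'.2.1 hb'.2.2
    rcases ha with rfl | rfl <;> rcases ha' with rfl | rfl
    · ring
    · rw [e1, e2]; ring
    · rw [e1, e2]; ring
    · ring

lemma SplitFree.twin_unique {X : Finset V} (h : SplitFree w X) (hX : 4 ≤ X.card)
    {x u v : V} {k l : F} (hu : u ∈ X) (hv : v ∈ X) (h1 : IsTwin w X x u k)
    (h2 : IsTwin w X x v l) : u = v := by
  by_contra huv
  refine h.not_twins hX hu hv huv (l - k) fun z hz hzu hzv => ?_
  linear_combination h2 z hz hzv - h1 z hz hzu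

/-- If adding a vertex to a split-free set creates a split, the new vertex has a twin. -/
lemma SplitFree.exists_twin (hw : ∀ a b, w a b = w b a) {X : Finset V} (h : SplitFree w X)
    {x : V} (hx : x ∉ X) (hins : ¬ SplitFree w (insert x X)) :
    ∃ u ∈ X, ∃ k, IsTwin w X x u k := by
  have : ∃ A, IsSplit w (insert x X) A ∧ x ∈ A := by
    simp only [SplitFree, not_forall, not_not] at hins
    obtain ⟨A, hA⟩ := hins
    by_cases hxA : x ∈ A
    · exact ⟨A, hA, hxA⟩
    · exact ⟨_, hA.compl hw, by simp [hxA]⟩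
  obtain ⟨A, hA, hxA⟩ := this
  have hAX : A ∩ X = A.erase x := by
    ext z
    have := @hA.1 z
    simp only [Finset.mem_inter, Finset.mem_erase, Finset.mem_insert] at *
    constructor
    · rintro ⟨h1, h2⟩; exact ⟨fun e => hx (e ▸ h2), h1⟩
    · rintro ⟨h1, h2⟩; exact ⟨h2, (this h2).resolve_left h1⟩
  have hXA : X \ A = insert x X \ A := by
    rw [Finset.insert_sdiff_of_mem _ hxA]
  have hcard : (A ∩ X).card = A.card - 1 := by rw [hAX, Finset.card_erase_of_mem hxA]
  have h2A := hA.2.1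
  have hA1 : (A ∩ X).card = 1 := by
    by_contra hne
    exact h _ (hA.restrict (Finset.subset_insert _ _) (by omega) (by rw [hXA]; exact hA.2.2.1))
  obtain ⟨u, hu⟩ := Finset.card_eq_one.1 hA1
  have huAX : u ∈ A ∩ X := by simp [hu]
  rw [Finset.mem_inter] at huAX
  have h2 := hA.2.2.1
  obtain ⟨b, hb⟩ : (insert x X \ A).Nonempty := Finset.card_pos.1 (by omega)
  refine ⟨u, huAX.2, w x b - w u b, fun z hz hzu => ?_⟩
  have hzA : z ∉ A := fun hzA => by
    have : z ∈ A ∩ X := Finset.mem_inter.2 ⟨hzA, hz⟩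
    rw [hu, Finset.mem_singleton] at this
    exact hzu this
  have := hA.2.2.2 x hxA u huAX.1 z (by rw [← hXA]; exact Finset.mem_sdiff.2 ⟨hz, hzA⟩) b hb
  linear_combination this

/-- Adding to a split-free set twins `x`, `y` of distinct vertices `u`, `v` keeps it split-free if
the weight between `x` and `y` is not the one forced by being twins. -/
lemma SplitFree.insert_insert (hw : ∀ a b, w a b = w b a) {X : Finset V} (h : SplitFree w X)
    (hX : 4 ≤ X.card) {x y u v : V} {k l : F} (hu : u ∈ X)
    (hv : v ∈ X) (huv : u ≠ v) (hx : IsTwin w X x u k) (hy : IsTwin w X y v l)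
    (hxy : w x y ≠ w u v + k + l) : SplitFree w (insert x (insert y X)) := by
  have hne : x ≠ y := by
    rintro rfl
    exact huv (h.twin_unique hX hu hv hx hy)
  have huy : w u y = w u v + l := by rw [hw, hy u hu huv, hw v u]
  have hxv : w x v = w u v + k := hx v hv huv.symm
  have hXY : X ⊆ insert x (insert y X) := fun z hz => by simp [hz]
  have main : ∀ A, IsSplit w (insert x (insert y X)) A → ¬ (A ∩ X).card ≤ 1 := by
    intro A hA hcard
    have key := hA.2.2.2
    have memc : ∀ z ∈ X, z ∉ A → z ∈ insert x (insert y X) \ A := fun z hz hzA =>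
      Finset.mem_sdiff.2 ⟨hXY hz, hzA⟩
    have hmem : ∀ z ∈ A, z = x ∨ z = y ∨ z ∈ X := fun z hz => by simpa using hA.1 hz
    rcases Nat.le_one_iff_eq_zero_or_eq_one.1 hcard with h0 | h1
    · have hAX : ∀ z ∈ X, z ∉ A := fun z hz hzA => by
        have : z ∈ A ∩ X := Finset.mem_inter.2 ⟨hzA, hz⟩
        rw [Finset.card_eq_zero.1 h0] at this
        simp at this
      have hsub : A ⊆ {x, y} := fun z hz => by
        rcases hmem z hz with h | h | h
        · simp [h]
        · simp [h]
        · exact absurd hz (hAX z h)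
      have hAe : A = {x, y} := Finset.eq_of_subset_of_card_le hsub
        (by rw [Finset.card_pair hne]; exact hA.2.1)
      have hxA : x ∈ A := by simp [hAe]
      have hyA : y ∈ A := by simp [hAe]
      refine h.not_twins hX hu hv huv (w x u - w y u - k + l) fun z hz hzu hzv => ?_
      have := key x hxA y hyA z (memc z hz (hAX z hz)) u (memc u hu (hAX u hu))
      linear_combination this - hx z hz hzu + hy z hz hzv
    · obtain ⟨t, ht⟩ := Finset.card_eq_one.1 h1
      have htAX : t ∈ A ∩ X := by simp [ht]
      rw [Finset.mem_inter] at htAX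
      have hAX : ∀ z ∈ X, z ≠ t → z ∉ A := fun z hz hzt hzA => by
        have : z ∈ A ∩ X := Finset.mem_inter.2 ⟨hzA, hz⟩
        rw [ht, Finset.mem_singleton] at this
        exact hzt this
      obtain ⟨b, hbX, hbt⟩ : ∃ b ∈ X, b ≠ t :=
        Finset.exists_mem_ne (by omega) t
      have twin : ∀ z ∈ A, IsTwin w X z t (w z b - w t b) := fun z hz c hc hct => by
        have := key z hz t htAX.1 c (memc c hc (hAX c hc hct)) b (memc b hbX (hAX b hbX hbt))
        linear_combination this
      have hxt : x ∈ A → t = u := fun hxA => h.twin_unique hX htAX.2 hu (twin x hxA) hx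
      have hyt : y ∈ A → t = v := fun hyA => h.twin_unique hX htAX.2 hv (twin y hyA) hy
      by_cases hxA : x ∈ A
      · by_cases hyA : y ∈ A
        · exact huv ((hxt hxA).symm.trans (hyt hyA))
        · obtain rfl := hxt hxA
          have := key x hxA t htAX.1 y (Finset.mem_sdiff.2 ⟨by simp, hyA⟩) b
            (memc b hbX (hAX b hbX hbt))
          have e := hx b hbX hbt
          apply hxy
          linear_combination this + e + huy
      · by_cases hyA : y ∈ A
        · obtain rfl := hyt hyA
          have := key y hyA t htAX.1 x (Finset.mem_sdiff.2 ⟨by simp, hxA⟩) b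
            (memc b hbX (hAX b hbX hbt))
          have e := hy b hbX hbt
          apply hxy
          have e1 := hw x y
          have e2 := hw x t
          linear_combination this + e + hxv + e1 - e2
        · have hsub : A ⊆ {t} := fun z hz => by
            rcases hmem z hz with h | h | h
            · exact absurd (h ▸ hz) hxA
            · exact absurd (h ▸ hz) hyA
            · by_contra hzt
              exact hAX z h (by simpa using hzt) hz
          have := Finset.card_le_card hsub
          have := hA.2.1
          simp at *
          omega
  intro A hA
  have h1 := main A hA
  have h2 := main _ (hA.compl hw)
  have h3 : (insert x (insert y X) \ A) ∩ X = X \ A := by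
    ext z; have := @hXY z; simp only [Finset.mem_inter, Finset.mem_sdiff]; tauto
  rw [h3] at h2
  exact h _ (hA.restrict hXY (by omega) (by omega))

/-- One step of growing a split-free subset inside a split-free set. -/
lemma SplitFree.grow (hw : ∀ a b, w a b = w b a) {X Y : Finset V} (hX : SplitFree w X)
    (hY : SplitFree w Y) (hX4 : 4 ≤ X.card) (hXY : X ⊂ Y) :
    (∃ x ∈ Y, x ∉ X ∧ SplitFree w (insert x X)) ∨
    ∃ x ∈ Y, ∃ y ∈ Y, x ∉ X ∧ y ∉ X ∧ ∃ u ∈ X, ∃ v ∈ X, u ≠ v ∧ ∃ k l,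
      IsTwin w X x u k ∧ IsTwin w X y v l ∧ w x y ≠ w u v + k + l := by
  by_contra! hcon
  obtain ⟨h1, h2⟩ := hcon
  have tw : ∀ x ∈ Y, x ∉ X → ∃ u ∈ X, ∃ k, IsTwin w X x u k := fun x hx hxX =>
    hX.exists_twin hw hxX (h1 x hx hxX)
  obtain ⟨x, hxY, hxX⟩ := Finset.exists_of_ssubset hXY
  obtain ⟨u, hu, k, hk⟩ := tw x hxY hxX
  classical
  set A : Finset V := Y.filter fun z => z = u ∨ (z ∉ X ∧ ∃ k, IsTwin w X z u k) with hA
  have huA : u ∈ A := by simp [hA, hXY.1 hu]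
  have hxA : x ∈ A := by simp only [hA, Finset.mem_filter]; exact ⟨hxY, Or.inr ⟨hxX, k, hk⟩⟩
  have hxu : x ≠ u := fun e => hxX (e ▸ hu)
  have hsub : X.erase u ⊆ Y \ A := by
    intro z hz
    rw [Finset.mem_erase] at hz
    simp only [hA, Finset.mem_sdiff, Finset.mem_filter, not_and, not_or]
    exact ⟨hXY.1 hz.2, fun _ => ⟨hz.1, fun h => absurd hz.2 h⟩⟩
  have const : ∀ a ∈ A, ∃ c, ∀ b ∈ Y \ A, w a b = w u b + c := by
    intro a ha
    simp only [hA, Finset.mem_filter] at ha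
    rcases ha with ⟨haY, rfl | ⟨haX, c, hc⟩⟩
    · exact ⟨0, fun b _ => by ring⟩
    · refine ⟨c, fun b hb => ?_⟩
      simp only [hA, Finset.mem_sdiff, Finset.mem_filter, not_and, not_or] at hb
      obtain ⟨hbY, hb⟩ := hb
      by_cases hbX : b ∈ X
      · exact hc b hbX (hb hbY).1
      · obtain ⟨v, hv, l, hl⟩ := tw b hbY hbX
        have huv : u ≠ v := by
          rintro rfl
          exact (hb hbY).2 hbX ⟨l, hl⟩
        have e1 := h2 a haY b hbY haX hbX u hu v hv huv c l hc hl
        have e2 := hl u hu huv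
        rw [e1, hw u b, e2, hw v u]; ring
  refine hY A ⟨Finset.filter_subset _ _, ?_, ?_, ?_⟩
  · rw [← Finset.card_pair hxu]
    apply Finset.card_le_card
    intro z hz
    simp at hz
    rcases hz with rfl | rfl <;> assumption
  · have := Finset.card_le_card hsub
    rw [Finset.card_erase_of_mem hu] at this
    omega
  · intro a ha a' ha' b hb b' hb'
    obtain ⟨c, hc⟩ := const a ha
    obtain ⟨c', hc'⟩ := const a' ha'
    rw [hc b hb, hc b' hb', hc' b hb, hc' b' hb']; ring

lemma splitFree_four {a b c d : V} (hw : ∀ a b, w a b = w b a)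
    (hab : a ≠ b) (hac : a ≠ c) (had : a ≠ d) (hbc : b ≠ c) (hbd : b ≠ d) (hcd : c ≠ d) :
    SplitFree w {a, b, c, d} ↔ w a b + w c d ≠ w a c + w b d ∧
      w a b + w c d ≠ w a d + w b c ∧ w a c + w b d ≠ w a d + w b c := by
  have hcard : ({a, b, c, d} : Finset V).card = 4 := by
    rw [Finset.card_eq_succ]
    exact ⟨a, {b, c, d}, by simp [*], rfl, by rw [Finset.card_eq_three]; exact ⟨b, c, d, hbc, hbd, hcd, rfl⟩⟩
  constructor
  · intro h
    refine ⟨fun e => ?_, fun e => ?_, fun e => ?_⟩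
    · refine h.not_twins hcard.ge (u := a) (v := d) (by simp) (by simp) had (w a b - w d b)
        fun z hz h1 h2 => ?_
      simp only [Finset.mem_insert, Finset.mem_singleton] at hz
      rcases hz with rfl | rfl | rfl | rfl
      · exact absurd rfl h1
      · ring
      · linear_combination - e + hw z d - hw b d
      · exact absurd rfl h2
    · refine h.not_twins hcard.ge (u := a) (v := c) (by simp) (by simp) hac (w a b - w c b)
        fun z hz h1 h2 => ?_
      simp only [Finset.mem_insert, Finset.mem_singleton] at hz
      rcases hz with rfl | rfl | rfl | rfl
      · exact absurd rfl h1
      · ring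
      · exact absurd rfl h2
      · linear_combination - e - hw b c
    · refine h.not_twins hcard.ge (u := a) (v := b) (by simp) (by simp) hab (w a c - w b c)
        fun z hz h1 h2 => ?_
      simp only [Finset.mem_insert, Finset.mem_singleton] at hz
      rcases hz with rfl | rfl | rfl | rfl
      · exact absurd rfl h1
      · exact absurd rfl h2
      · ring
      · linear_combination - e
  · rintro ⟨e1, e2, e3⟩
    have main : ∀ A, IsSplit w {a, b, c, d} A → a ∉ A := by
      intro A hA haA
      have h1 := hA.2.1
      have h2 := hA.2.2.1
      have h3 := Finset.card_sdiff_add_card_eq_card hA.1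
      rw [hcard] at h3
      obtain ⟨r, hr, hra⟩ := Finset.exists_mem_ne (s := A) (by omega) a
      have hAe : ({a, r} : Finset V) = A := by
        apply Finset.eq_of_subset_of_card_le
        · intro z hz
          simp at hz
          rcases hz with rfl | rfl <;> assumption
        · rw [Finset.card_pair hra.symm]; omega
      have key := hA.2.2.2
      have hr' := hA.1 hr
      simp only [Finset.mem_insert, Finset.mem_singleton] at hr'
      subst hAe
      rcases hr' with rfl | rfl | rfl | rfl
      · exact hra rfl
      · have := key a (by simp) r (by simp) c (by simp [hac.symm, hbc.symm]) d
          (by simp [had.symm, hbd.symm])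
        exact e3 (by linear_combination this)
      · have := key a (by simp) r (by simp) b (by simp [hab.symm, hbc]) d
          (by simp [had.symm, hcd.symm])
        exact e2 (by linear_combination this + hw r b)
      · have := key a (by simp) r (by simp) b (by simp [hab.symm, hbd]) c
          (by simp [hac.symm, hcd])
        exact e1 (by linear_combination this + hw r b - hw r c)
    intro A hA
    have := main _ (hA.compl hw)
    simp [main A hA] at this

/-- A colouring of the edges of a complete graph without rainbow triangles and without the
four-vertex pattern excluded by `hP` admits a partition into two nonempty parts such that all
edges between them have the same colour. -/
lemma exists_monochromatic_cut (hw : ∀ a b, w a b = w b a) (h2 : (2 : F) ≠ 0) (S : Finset V)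
    (hG : ∀ a ∈ S, ∀ b ∈ S, ∀ c ∈ S, a ≠ b → a ≠ c → b ≠ c →
      ¬ (w a b ≠ w a c ∧ w a b ≠ w b c ∧ w a c ≠ w b c))
    (hP : ∀ a ∈ S, ∀ b ∈ S, ∀ c ∈ S, ∀ d ∈ S, a ≠ b → a ≠ c → a ≠ d → b ≠ c → b ≠ d → c ≠ d →
      ¬ (w a b + w c d ≠ w a c + w b d ∧ w a b + w c d ≠ w a d + w b c ∧
        w a c + w b d ≠ w a d + w b c)) (hS : 2 ≤ S.card) :
    ∃ A B : Finset V, A.Nonempty ∧ B.Nonempty ∧ Disjoint A B ∧ A ∪ B = S ∧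
      ∃ c, ∀ a ∈ A, ∀ b ∈ B, w a b = c := by
  induction S using Finset.induction_on with
  | empty => simp at hS
  | insert v S hv ih =>
    rw [Finset.card_insert_of_notMem hv] at hS
    by_cases hS2 : S.card = 1
    · obtain ⟨s, rfl⟩ := Finset.card_eq_one.1 hS2
      exact ⟨{v}, {s}, by simp, by simp, by simpa using hv, rfl, w v s, by simp⟩
    obtain ⟨A₀, B₀, hA₀, hB₀, hd₀, hu₀, c, hc₀⟩ := ih
      (fun a ha b hb c hc => hG a (by simp [ha]) b (by simp [hb]) c (by simp [hc]))
      (fun a ha b hb c hc d hd => hP a (by simp [ha]) b (by simp [hb]) c (by simp [hc]) d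
        (by simp [hd])) (by omega)
    have hne : ∀ z ∈ S, v ≠ z := fun z hz e => hv (e ▸ hz)
    by_cases hz : ∃ z ∈ S, w v z = c
    · obtain ⟨z, hzS, hzc⟩ := hz
      obtain ⟨A, ⟨hzA, B, hB, hd, hu, hc⟩, hmin⟩ : ∃ A : Finset V, (z ∈ A ∧ ∃ B : Finset V,
          B.Nonempty ∧ Disjoint A B ∧ A ∪ B = S ∧ ∀ a ∈ A, ∀ b ∈ B, w a b = c) ∧
          ∀ A', A' ⊂ A → ¬ (z ∈ A' ∧ ∃ B : Finset V,
          B.Nonempty ∧ Disjoint A' B ∧ A' ∪ B = S ∧ ∀ a ∈ A', ∀ b ∈ B, w a b = c) := by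
        have hex : ∃ A : Finset V, z ∈ A ∧ ∃ B : Finset V,
            B.Nonempty ∧ Disjoint A B ∧ A ∪ B = S ∧ ∀ a ∈ A, ∀ b ∈ B, w a b = c := by
          rw [← hu₀, Finset.mem_union] at hzS
          rcases hzS with h | h
          · exact ⟨A₀, h, B₀, hB₀, hd₀, hu₀, hc₀⟩
          · exact ⟨B₀, h, A₀, hA₀, hd₀.symm, by rw [Finset.union_comm, hu₀],
              fun a ha b hb => by rw [hw, hc₀ b hb a ha]⟩
        obtain ⟨A, hA, hmin⟩ := WellFounded.has_min (wellFounded_lt (α := Finset V))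
          {A | z ∈ A ∧ ∃ B : Finset V,
            B.Nonempty ∧ Disjoint A B ∧ A ∪ B = S ∧ ∀ a ∈ A, ∀ b ∈ B, w a b = c} hex
        exact ⟨A, hA, fun A' hlt h => hmin A' h hlt⟩
      have hAS : ∀ a ∈ A, a ∈ S := fun a ha => by rw [← hu]; simp [ha]
      have hBS : ∀ a ∈ B, a ∈ S := fun a ha => by rw [← hu]; simp [ha]
      have hAB : ∀ a ∈ A, ∀ b ∈ B, a ≠ b := fun a ha b hb => by
        rintro rfl; exact Finset.disjoint_left.1 hd ha hb
      by_cases hvA : ∀ a ∈ A, w v a = c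
      · refine ⟨A, insert v B, ⟨z, hzA⟩, by simp, ?_, by rw [Finset.union_insert, hu], c, ?_⟩
        · rw [Finset.disjoint_insert_right]
          exact ⟨fun h => hv (hAS v h), hd⟩
        · intro a ha b hb
          rcases Finset.mem_insert.1 hb with rfl | hb
          · rw [hw, hvA a ha]
          · exact hc a ha b hb
      by_cases hvB : ∀ b ∈ B, w v b = c
      · refine ⟨B, insert v A, hB, by simp, ?_, by rw [Finset.union_insert, Finset.union_comm, hu],
          c, ?_⟩
        · rw [Finset.disjoint_insert_right]
          exact ⟨fun h => hv (hBS v h), hd.symm⟩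
        · intro b hb a ha
          rcases Finset.mem_insert.1 ha with rfl | ha
          · rw [hw, hvB b hb]
          · rw [hw, hc a ha b hb]
      exfalso
      push Not at hvA hvB
      obtain ⟨a₀, ha₀, hva₀⟩ := hvA
      obtain ⟨b, hb, hvb⟩ := hvB
      have hvd : ∀ a ∈ A, w v a ≠ c → w v a = w v b := fun a ha hva => by
        by_contra hcon
        refine hG v (by simp) a (by simp [hAS a ha]) b (by simp [hBS b hb]) (hne a (hAS a ha))
          (hne b (hBS b hb)) (hAB a ha b hb) ⟨hcon, ?_, ?_⟩ <;> rwa [hc a ha b hb]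
      have hedge : ∃ a ∈ A, w v a = c ∧ ∃ a' ∈ A, w v a' ≠ c ∧ w a a' ≠ c := by
        classical
        by_contra! hcon
        refine hmin (A.filter fun a => w v a = c) (Finset.filter_ssubset.2 ⟨a₀, ha₀, hva₀⟩)
          ⟨by simp [hzA, hzc], B ∪ A.filter (fun a => ¬ w v a = c), hB.inl, ?_, ?_, ?_⟩
        · rw [Finset.disjoint_union_right]
          exact ⟨hd.mono_left (Finset.filter_subset _ _), Finset.disjoint_filter_filter_not _ _ _⟩
        · rw [Finset.union_comm B, ← Finset.union_assoc, Finset.filter_union_filter_not_eq, hu]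
        · intro a ha b' hb'
          simp only [Finset.mem_filter, Finset.mem_union] at ha hb'
          rcases hb' with hb' | hb'
          · exact hc a ha.1 b' hb'
          · exact hcon a ha.1 ha.2 b' hb'.1 hb'.2
      obtain ⟨a, ha, hva, a', ha', hva', haa'⟩ := hedge
      have hne' : a ≠ a' := by rintro rfl; exact hva' hva
      have e1 := hvd a' ha' hva'
      have e2 : w a a' = w v b := by
        by_contra hcon
        refine hG v (by simp) a (by simp [hAS a ha]) a' (by simp [hAS a' ha']) (hne a (hAS a ha))
          (hne a' (hAS a' ha')) hne' ⟨?_, ?_, ?_⟩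
        · rw [hva]; exact hva'.symm
        · rw [hva]; exact haa'.symm
        · rw [e1]; exact fun h => hcon h.symm
      have hsub : w v b - c ≠ 0 := sub_ne_zero.2 hvb
      have hsub2 : 2 * (w v b - c) ≠ 0 := mul_ne_zero h2 hsub
      refine hP a (by simp [hAS a ha]) a' (by simp [hAS a' ha']) v (by simp) b
        (by simp [hBS b hb]) hne' (hne a (hAS a ha)).symm (hAB a ha b hb)
        (hne a' (hAS a' ha')).symm (hAB a' ha' b hb) (hne b (hBS b hb)) ?_
      rw [e2, hw a v, hva, hc a' ha' b hb, hc a ha b hb, hw a' v, e1]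
      refine ⟨fun h => hsub2 ?_, fun h => hsub ?_, fun h => hsub ?_⟩
      · linear_combination h
      · linear_combination h
      · linear_combination -h
    · push Not at hz
      have hcross : ∀ a ∈ A₀, ∀ b ∈ B₀, w v a = w v b := fun a ha b hb => by
        have haS : a ∈ S := by rw [← hu₀]; simp [ha]
        have hbS : b ∈ S := by rw [← hu₀]; simp [hb]
        by_contra hcon
        refine hG v (by simp) a (by simp [haS]) b (by simp [hbS]) (hne a haS)
          (hne b hbS) (fun e => Finset.disjoint_left.1 hd₀ ha (e ▸ hb)) ⟨hcon, ?_, ?_⟩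
        · rw [hc₀ a ha b hb]; exact hz a haS
        · rw [hc₀ a ha b hb]; exact hz b hbS
      obtain ⟨a, ha⟩ := hA₀
      obtain ⟨b, hb⟩ := hB₀
      refine ⟨{v}, S, by simp, Finset.card_pos.1 (by omega), by simpa using hv, rfl, w v b, ?_⟩
      intro v' hv' s hs
      rw [Finset.mem_singleton] at hv'
      subst hv'
      rw [← hu₀, Finset.mem_union] at hs
      rcases hs with hs | hs
      · exact hcross s hs b hb
      · rw [← hcross a ha s hs, hcross a ha b hb]

lemma SplitFree.exists_four (hw : ∀ a b, w a b = w b a) (h2 : (2 : F) ≠ 0) {X : Finset V}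
    (hX : SplitFree w X) (hX4 : 4 ≤ X.card) : ∃ Y ⊆ X, Y.card = 4 ∧ SplitFree w Y := by
  by_contra! hcon
  have four : ∀ a ∈ X, ∀ b ∈ X, ∀ c ∈ X, ∀ d ∈ X, a ≠ b → a ≠ c → a ≠ d → b ≠ c → b ≠ d → c ≠ d →
      ¬ (w a b + w c d ≠ w a c + w b d ∧ w a b + w c d ≠ w a d + w b c ∧
        w a c + w b d ≠ w a d + w b c) := by
    intro a ha b hb c hc d hd hab hac had hbc hbd hcd h
    refine hcon {a, b, c, d} ?_ ?_ ((splitFree_four hw hab hac had hbc hbd hcd).2 h)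
    · intro z hz
      simp at hz
      rcases hz with rfl | rfl | rfl | rfl <;> assumption
    · rw [Finset.card_eq_succ]
      exact ⟨a, {b, c, d}, by simp [*], rfl,
        by rw [Finset.card_eq_three]; exact ⟨b, c, d, hbc, hbd, hcd, rfl⟩⟩
  obtain ⟨o, ho⟩ : X.Nonempty := Finset.card_pos.1 (by omega)
  obtain ⟨A, B, hA, hB, hd, hu, c, hc⟩ := exists_monochromatic_cut
    (w := fun a b => w a b - w o a - w o b) (fun a b => by simp only [hw a b]; ring) h2
    (X.erase o) (by
        intro a ha b hb c hc hab hac hbc h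
        rw [Finset.mem_erase] at ha hb hc
        refine four o ho a ha.2 b hb.2 c hc.2 ha.1.symm hb.1.symm hc.1.symm hab hac hbc
          ⟨fun e => h.2.2 ?_, fun e => h.2.1 ?_, fun e => h.1 ?_⟩
        · linear_combination -e
        · linear_combination -e
        · linear_combination -e) (by
        intro a ha b hb c hc d hd hab hac had hbc hbd hcd h
        rw [Finset.mem_erase] at ha hb hc hd
        refine four a ha.2 b hb.2 c hc.2 d hd.2 hab hac had hbc hbd hcd
          ⟨fun e => h.1 ?_, fun e => h.2.1 ?_, fun e => h.2.2 ?_⟩ <;> linear_combination e)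
    (by rw [Finset.card_erase_of_mem ho]; omega)
  have hcard : A.card + B.card = X.card - 1 := by
    rw [← Finset.card_union_of_disjoint hd, hu, Finset.card_erase_of_mem ho]
  have big : ∀ A B : Finset V, 2 ≤ A.card → B.Nonempty → Disjoint A B → A ∪ B = X.erase o →
      (∀ a ∈ A, ∀ b ∈ B, w a b - w o a - w o b = c) → False := by
    intro A B hA hB hd hu hc
    have hAX : A ⊆ X := fun a ha => Finset.mem_of_mem_erase
      (by rw [← hu]; exact Finset.mem_union_left _ ha)
    have hXA : X \ A = insert o B := by
      ext z
      have h1 : z ∈ A ∪ B ↔ z ∈ X.erase o := by rw [hu]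
      have h2 : z ∈ A → z ∉ B := fun h => Finset.disjoint_left.1 hd h
      simp only [Finset.mem_union, Finset.mem_erase, Finset.mem_sdiff, Finset.mem_insert] at h1 ⊢
      by_cases hzo : z = o
      · subst hzo; tauto
      · tauto
    have hoB : o ∉ B := fun h => by
      have : o ∈ X.erase o := by rw [← hu]; exact Finset.mem_union_right _ h
      simp at this
    have hBc := Finset.card_pos.2 hB
    refine hX A ⟨hAX, hA, by rw [hXA, Finset.card_insert_of_notMem hoB]; omega, ?_⟩
    rw [hXA]
    have val : ∀ a ∈ A, ∀ b ∈ insert o B, w a b = w o a + if b = o then 0 else w o b + c := by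
      intro a ha b hb
      rcases Finset.mem_insert.1 hb with rfl | hb
      · rw [if_pos rfl, hw, add_zero]
      · rw [if_neg fun e : b = o => hoB (by rwa [e] at hb)]
        linear_combination hc a ha b hb
    intro a ha a' ha' b hb b' hb'
    rw [val a ha b hb, val a' ha' b' hb', val a ha b' hb', val a' ha' b hb]
    ring
  by_cases h : 2 ≤ A.card
  · exact big A B h hB hd hu hc
  · refine big B A (by omega) hA hd.symm (by rw [Finset.union_comm, hu]) fun b hb a ha => ?_
    rw [hw b a]
    linear_combination hc a ha b hb
lemma splitFree_five_of_twins (hw : ∀ a b, w a b = w b a) {u v c d x y : V} {k l m n : F}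
    (huv : u ≠ v) (huc : u ≠ c) (hud : u ≠ d) (hvc : v ≠ c) (hvd : v ≠ d) (hcd : c ≠ d)
    (hxu : x ≠ u) (hxv : x ≠ v) (hxc : x ≠ c) (hxd : x ≠ d) (hyu : y ≠ u) (hyv : y ≠ v)
    (hyd : y ≠ d) (hxy : x ≠ y) (hX : SplitFree w {u, v, c, d})
    (hx : IsTwin w {u, v, c, d} x u k) (hy : IsTwin w {u, v, c, d} y v l)
    (hδ : w x y ≠ w u v + k + l) (hyc : IsTwin w {x, v, c, d} y c m)
    (hxd' : IsTwin w {y, u, c, d} x d n) :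
    SplitFree w (insert u {x, y, d, v}) := by
  rw [splitFree_four hw huv huc hud hvc hvd hcd] at hX
  have x1 := hx v (by simp) huv.symm
  have x2 := hx c (by simp) huc.symm
  have x3 := hx d (by simp) hud.symm
  have y1 := hy u (by simp) huv
  have y2 := hy c (by simp) hvc.symm
  have y3 := hy d (by simp) hvd.symm
  have s1 := hyc v (by simp) hvc
  have s2 := hyc d (by simp) hcd.symm
  have s3 := hyc x (by simp) hxc
  have t1 := hxd' u (by simp) hud
  have t2 := hxd' c (by simp) hcd
  have t3 := hxd' y (by simp) hyd
  rw [hw y x, hw c x] at s3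
  rw [hw d y] at t3
  rw [hw d u] at t1
  rw [hw v u] at y1
  rw [hw c v] at s1
  rw [hw d c] at t2
  have f4 : SplitFree w {x, y, d, v} := by
    rw [splitFree_four hw hxy hxd hxv hyd hyv hvd.symm]
    rw [hw d v]
    grind
  by_contra hcon
  obtain ⟨t, ht, r, hr⟩ := f4.exists_twin hw (by simp [*, Ne.symm]) hcon
  simp only [Finset.mem_insert, Finset.mem_singleton] at ht
  rcases ht with rfl | rfl | rfl | rfl
  · have r1 := hr y (by simp) hxy.symm
    have r2 := hr v (by simp) hxv.symm
    grind
  · have r1 := hr x (by simp) hxy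
    have r2 := hr d (by simp) hyd.symm
    have r3 := hr v (by simp) hyv.symm
    grind
  · have r1 := hr x (by simp) hxd
    have r2 := hr y (by simp) hyd
    have r3 := hr v (by simp) hvd
    rw [hw t x] at r1
    rw [hw t y] at r2
    rw [hw t v] at r3
    grind
  · have r1 := hr x (by simp) hxv
    have r2 := hr y (by simp) hyv
    have r3 := hr d (by simp) hvd.symm
    rw [hw t x] at r1
    rw [hw t y] at r2
    grind

/-- The six-vertex case of `SplitFree.exists_erase`. -/
lemma SplitFree.exists_erase_of_card_four (hw : ∀ a b, w a b = w b a) {X : Finset V}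
    (hX : SplitFree w X) (hX4 : X.card = 4) {x y u v : V} {k l : F} (hxX : x ∉ X) (hyX : y ∉ X)
    (hxy : x ≠ y) (hu : u ∈ X) (hv : v ∈ X) (huv : u ≠ v) (hx : IsTwin w X x u k)
    (hy : IsTwin w X y v l) (hδ : w x y ≠ w u v + k + l) :
    ∃ z ∈ insert x (insert y X), SplitFree w ((insert x (insert y X)).erase z) := by
  obtain ⟨c, d, hcd, hcdX⟩ := Finset.card_eq_two.1
    (show ((X.erase u).erase v).card = 2 by
      rw [Finset.card_erase_of_mem (Finset.mem_erase.2 ⟨huv.symm, hv⟩),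
        Finset.card_erase_of_mem hu]
      omega)
  have hXe : X = {u, v, c, d} := by
    rw [← Finset.insert_erase hu, ← Finset.insert_erase (Finset.mem_erase.2 ⟨huv.symm, hv⟩), hcdX]
  have hc : c ∈ (X.erase u).erase v := by simp [hcdX]
  have hd : d ∈ (X.erase u).erase v := by simp [hcdX]
  simp only [Finset.mem_erase, ne_eq] at hc hd
  obtain ⟨hvc, huc, -⟩ := hc
  obtain ⟨hvd, hud, -⟩ := hd
  rw [eq_comm] at hvc huc hvd hud
  clear hcdX hu hv hX4
  subst hXe
  simp only [Finset.mem_insert, Finset.mem_singleton, not_or] at hxX hyX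
  obtain ⟨hxu, hxv, hxc, hxd⟩ := hxX
  obtain ⟨hyu, hyv, hyc, hyd⟩ := hyX
  by_contra! hcon
  have four := (splitFree_four hw huv huc hud hvc hvd hcd).1 hX
  have x1 := hx v (by simp) huv.symm
  have x2 := hx c (by simp) (Ne.symm huc)
  have x3 := hx d (by simp) (Ne.symm hud)
  have y1 := hy u (by simp) huv
  have y2 := hy c (by simp) (Ne.symm hvc)
  have y3 := hy d (by simp) (Ne.symm hvd)
  rw [hw v u] at y1
  have f1 : SplitFree w {x, v, c, d} := by
    rw [splitFree_four hw hxv hxc hxd hvc hvd hcd]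
    grind
  have f2 : SplitFree w {y, u, c, d} := by
    rw [splitFree_four hw hyu hyc hyd huc hud hcd]
    grind
  have g1 : ¬ SplitFree w (insert y {x, v, c, d}) := by
    convert hcon u (by simp) using 2
    ext z; simp only [Finset.mem_insert, Finset.mem_singleton, Finset.mem_erase]; grind
  have g2 : ¬ SplitFree w (insert x {y, u, c, d}) := by
    convert hcon v (by simp) using 2
    ext z; simp only [Finset.mem_insert, Finset.mem_singleton, Finset.mem_erase]; grind
  have g3 : ¬ SplitFree w (insert u {x, y, d, v}) := by
    convert hcon c (by simp) using 2
    ext z; simp only [Finset.mem_insert, Finset.mem_singleton, Finset.mem_erase]; grind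
  have g4 : ¬ SplitFree w (insert u {x, y, c, v}) := by
    convert hcon d (by simp) using 2
    ext z; simp only [Finset.mem_insert, Finset.mem_singleton, Finset.mem_erase]; grind
  obtain ⟨t, ht, m, hm⟩ := f1.exists_twin hw (by simp [*, Ne.symm]) g1
  obtain ⟨s, hs, n, hn⟩ := f2.exists_twin hw (by simp [*, Ne.symm]) g2
  simp only [Finset.mem_insert, Finset.mem_singleton] at ht hs
  have ht : t = c ∨ t = d := by
    rcases ht with rfl | rfl | h
    · have r1 := hm c (by simp) (Ne.symm hxc)
      have r2 := hm d (by simp) (Ne.symm hxd)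
      grind
    · have r1 := hm x (by simp) hxv
      have r2 := hm c (by simp) (Ne.symm hvc)
      have r3 := hw t x
      have r4 := hw y x
      grind
    · exact h
  have hs : s = c ∨ s = d := by
    rcases hs with rfl | rfl | h
    · have r1 := hn c (by simp) (Ne.symm hyc)
      have r2 := hn d (by simp) (Ne.symm hyd)
      grind
    · have r1 := hn y (by simp) hyu
      have r2 := hn c (by simp) (Ne.symm huc)
      have r3 := hw s y
      grind
    · exact h
  have swap : ({u, v, c, d} : Finset V) = {u, v, d, c} := by rw [Finset.pair_comm]
  have swap1 : ({x, v, c, d} : Finset V) = {x, v, d, c} := by rw [Finset.pair_comm]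
  have swap2 : ({y, u, c, d} : Finset V) = {y, u, d, c} := by rw [Finset.pair_comm]
  have same : ∀ c d, u ≠ c → v ≠ c → u ≠ d → v ≠ d → c ≠ d → x ≠ c → y ≠ c →
      SplitFree w {u, v, c, d} → IsTwin w {u, v, c, d} x u k → IsTwin w {u, v, c, d} y v l →
      IsTwin w {x, v, c, d} y c m → IsTwin w {y, u, c, d} x c n → False := by
    intro c d huc hvc hud hvd hcd hxc hyc hX hx hy hm hn
    have four := (splitFree_four hw huv huc hud hvc hvd hcd).1 hX
    have x1 := hx v (by simp) huv.symm
    have x2 := hx c (by simp) (Ne.symm huc)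
    have x3 := hx d (by simp) (Ne.symm hud)
    have y1 := hy u (by simp) huv
    have y2 := hy c (by simp) (Ne.symm hvc)
    have y3 := hy d (by simp) (Ne.symm hvd)
    have m1 := hm x (by simp) hxc
    have m2 := hm v (by simp) hvc
    have m3 := hm d (by simp) hcd.symm
    have n1 := hn y (by simp) hyc
    have n2 := hn u (by simp) huc
    have n3 := hn d (by simp) hcd.symm
    have e1 := hw v u
    have e2 := hw c u
    have e3 := hw c v
    have e4 := hw y x
    have e5 := hw c x
    have e6 := hw c y
    grind
  rcases ht with rfl | rfl <;> rcases hs with rfl | rfl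
  · exact same _ d huc hvc hud hvd hcd hxc hyc hX hx hy hm hn
  · exact g3 (splitFree_five_of_twins hw huv huc hud hvc hvd hcd hxu hxv hxc hxd hyu hyv hyd hxy
      hX hx hy hδ hm hn)
  · rw [swap] at hX hx hy
    rw [swap1] at hm
    rw [swap2] at hn
    exact g4 (splitFree_five_of_twins hw huv hud huc hvd hvc (Ne.symm hcd) hxu hxv hxd hxc hyu hyv
      hyc hxy hX hx hy hδ hm hn)
  · rw [swap] at hX hx hy
    rw [swap1] at hm
    rw [swap2] at hn
    exact same _ c hud hvd huc hvc (Ne.symm hcd) hxd hyd hX hx hy hm hn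

/-- A split-free set with at least five vertices remains split-free after deleting a suitable
vertex. -/
theorem SplitFree.exists_erase (hw : ∀ a b, w a b = w b a) (h2 : (2 : F) ≠ 0) {Y : Finset V}
    (hY : SplitFree w Y) (hY5 : 5 ≤ Y.card) : ∃ z ∈ Y, SplitFree w (Y.erase z) := by
  induction hN : Y.card using Nat.strong_induction_on generalizing Y with
  | _ N ih =>
  subst hN
  by_contra! hcon
  have hcard : ∀ X ⊂ Y, SplitFree w X → X.card + 2 ≤ Y.card := by
    intro X hXY hX
    have h1 := Finset.card_lt_card hXY
    by_contra hlt
    obtain ⟨z, hz, hzX⟩ := Finset.exists_of_ssubset hXY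
    refine hcon z hz ?_
    convert hX
    symm
    apply Finset.eq_of_subset_of_card_le
    · exact fun a ha => Finset.mem_erase.2 ⟨fun e => hzX (e ▸ ha), hXY.1 ha⟩
    · rw [Finset.card_erase_of_mem hz]; omega
  obtain ⟨X, ⟨hX, hX4, hXY⟩, hmax⟩ : ∃ X : Finset V, (SplitFree w X ∧ 4 ≤ X.card ∧ X ⊂ Y) ∧
      ∀ X' : Finset V, X ⊂ X' → ¬ (SplitFree w X' ∧ 4 ≤ X'.card ∧ X' ⊂ Y) := by
    obtain ⟨Z, hZY, hZ4, hZ⟩ := hY.exists_four hw h2 (by omega)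
    have hfin : {X : Finset V | SplitFree w X ∧ 4 ≤ X.card ∧ X ⊂ Y}.Finite :=
      Y.ssubsets.finite_toSet.subset fun X hX => by simpa using hX.2.2
    obtain ⟨X, hX⟩ := hfin.exists_maximal ⟨Z, hZ, hZ4.ge, hZY.ssubset_of_ne
      (by rintro rfl; omega)⟩
    exact ⟨X, hX.1, fun X' hlt h => hlt.not_ge (hX.2 h hlt.le)⟩
  have hc := hcard X hXY hX
  have ssub : ∀ x ∈ Y, insert x X ≠ Y → insert x X ⊂ Y := fun x hx hne =>
    (Finset.insert_subset hx hXY.1).ssubset_of_ne hne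
  rcases hX.grow hw hY hX4 hXY with ⟨x, hxY, hxX, hxS⟩ | ⟨x, hxY, y, hyY, hxX, hyX, u, hu, v, hv,
      huv, k, l, hk, hl, hδ⟩
  · have h1 := Finset.card_insert_of_notMem hxX
    exact hmax _ (Finset.ssubset_insert hxX) ⟨hxS, by omega,
      ssub x hxY (by rintro e; rw [e] at h1; omega)⟩
  have hxy : x ≠ y := by
    rintro rfl
    exact huv (hX.twin_unique hX4 hu hv hk hl)
  have hS := hX.insert_insert hw hX4 hu hv huv hk hl hδ
  have hYe : insert x (insert y X) = Y := by
    by_contra hne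
    refine hmax _ ?_ ⟨hS, ?_, ?_⟩
    · exact (Finset.ssubset_insert hyX).trans_subset (Finset.subset_insert _ _)
    · exact hX4.trans (Finset.card_le_card fun z hz => by simp [hz])
    · exact (Finset.insert_subset hxY (Finset.insert_subset hyY hXY.1)).ssubset_of_ne hne
  by_cases hX5 : X.card = 4
  · obtain ⟨z, hz, h⟩ :=
      hX.exists_erase_of_card_four hw hX5 hxX hyX hxy hu hv huv hk hl hδ
    rw [hYe] at hz h
    exact hcon z hz h
  obtain ⟨z, hz, hzS⟩ := ih X.card (Finset.card_lt_card hXY) hX (by omega) rfl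
  have hz4 : 4 ≤ (X.erase z).card := by rw [Finset.card_erase_of_mem hz]; omega
  have hYz : Y.erase z = insert x (insert y (X.erase z)) := by
    rw [← hYe, Finset.erase_insert_of_ne (by rintro rfl; exact hxX hz),
      Finset.erase_insert_of_ne (by rintro rfl; exact hyX hz)]
  refine hcon z (hXY.1 hz) ?_
  rw [hYz]
  have rest : ∀ {x u k}, IsTwin w X x u k → IsTwin w (X.erase z) x u k := fun h a ha =>
    h a (Finset.mem_of_mem_erase ha)
  have main : ∀ x y u v k l, x ∉ X → y ∉ X → x ≠ y → u ∈ X → v ∈ X → u ≠ v → IsTwin w X x u k →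
      IsTwin w X y v l → w x y ≠ w u v + k + l → z = u →
      SplitFree w (insert y (insert x (X.erase z))) := by
    rintro x y u v k l hxX hyX hxy hu hv huv hk hl hδ rfl
    have hX1 : SplitFree w (insert x (X.erase z)) := by
      by_contra hns
      obtain ⟨t, ht, r, hr⟩ := hzS.exists_twin hw (fun h => hxX (Finset.mem_of_mem_erase h)) hns
      rw [Finset.mem_erase] at ht
      refine hX.not_twins hX4 hu ht.2 ht.1.symm (r - k) fun c hc hcz hct => ?_
      linear_combination hr c (Finset.mem_erase.2 ⟨hcz, hc⟩) hct - hk c hc hcz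
    by_contra hns
    obtain ⟨t, ht, r, hr⟩ := hX1.exists_twin hw (by
      rw [Finset.mem_insert, not_or]
      exact ⟨hxy.symm, fun h => hyX (Finset.mem_of_mem_erase h)⟩) hns
    rcases Finset.mem_insert.1 ht with rfl | ht'
    · refine hX.not_twins hX4 hu hv huv (l - r - k) fun c hc hcz hcv => ?_
      have hct : c ≠ t := by rintro rfl; exact hxX hc
      linear_combination hl c hc hcv - hk c hc hcz -
        hr c (Finset.mem_insert_of_mem (Finset.mem_erase.2 ⟨hcz, hc⟩)) hct
    · have htv : v = t := hzS.twin_unique hz4 (Finset.mem_erase.2 ⟨huv.symm, hv⟩) ht' (rest hl)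
        fun c hc hct => hr c (Finset.mem_insert_of_mem hc) hct
      subst htv
      obtain ⟨b, hb, hbv⟩ := Finset.exists_mem_ne (s := X.erase z) (by omega) v
      have e1 := hr b (Finset.mem_insert_of_mem hb) hbv
      have e2 := rest hl b hb hbv
      have e3 := hr x (by simp) (by rintro rfl; exact hxX hv)
      have e4 := hk v hv huv.symm
      apply hδ
      linear_combination e3 + hw x y - hw x v + e4 + e2 - e1
  by_cases hzu : z = u
  · rw [Finset.insert_comm]
    exact main x y u v k l hxX hyX hxy hu hv huv hk hl hδ hzu
  by_cases hzv : z = v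
  · refine main y x v u l k hyX hxX hxy.symm hv hu huv.symm hl hk ?_ hzv
    rw [hw y x, hw v u]
    exact fun e => hδ (by linear_combination e)
  · exact hzS.insert_insert hw hz4 (Finset.mem_erase.2 ⟨fun e => hzu e.symm, hu⟩)
      (Finset.mem_erase.2 ⟨fun e => hzv e.symm, hv⟩) huv (rest hk) (rest hl) hδ

lemma IsSplit.map {V' : Type*} [DecidableEq V'] {w' : V' → V' → F} (σ : V' ↪ V) {X A : Finset V'}
    (h : IsSplit w' X A) (α β : V' → F)
    (hσ : ∀ a b, w' a b = w (σ a) (σ b) + α a + β b) : IsSplit w (X.map σ) (A.map σ) := by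
  obtain ⟨h1, h2, h3, h4⟩ := h
  have hd : X.map σ \ A.map σ = (X \ A).map σ := by
    ext z; simp only [Finset.mem_sdiff, Finset.mem_map]; grind [σ.injective.eq_iff]
  refine ⟨Finset.map_subset_map.2 h1, by rwa [Finset.card_map],
    by rwa [hd, Finset.card_map], ?_⟩
  rw [hd]
  intro a ha a' ha' b hb b' hb'
  rw [Finset.mem_map] at ha ha' hb hb'
  obtain ⟨a, ha, rfl⟩ := ha
  obtain ⟨a', ha', rfl⟩ := ha'
  obtain ⟨b, hb, rfl⟩ := hb
  obtain ⟨b', hb', rfl⟩ := hb'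
  have := h4 a ha a' ha' b hb b' hb'
  simp only [hσ] at this
  linear_combination this

end Splits

section Quadratic

variable {R : Type*} [CommRing R]

/-- `f` is a quadratic function with polar form `B`. -/
def HasPolarForm {ι : Type*} (f : (ι → R) → R) (B : (ι → R) →ₗ[R] (ι → R) →ₗ[R] R) : Prop :=
  ∀ x y, f (x + y) = f x + f y - f 0 + B x y

lemma HasPolarForm.symm {ι : Type*} {f : (ι → R) → R} {B : (ι → R) →ₗ[R] (ι → R) →ₗ[R] R}
    (h : HasPolarForm f B) (x y : ι → R) : B x y = B y x := by
  have h1 := h x y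
  have h2 := h y x
  rw [add_comm y x] at h2
  linear_combination h2 - h1

lemma HasPolarForm.comp_affine {ι κ : Type*} {f : (ι → R) → R}
    {B : (ι → R) →ₗ[R] (ι → R) →ₗ[R] R} (h : HasPolarForm f B) (M : (κ → R) →ₗ[R] (ι → R))
    (c : ι → R) (e : R) : HasPolarForm (fun x => f (M x + c) + e) (B.compl₁₂ M M) := by
  intro x y
  have h1 := h (M x) (M y + c)
  have h2 := h (M x) c
  simp only [map_add, map_zero, zero_add, LinearMap.compl₁₂_apply] at *
  rw [add_assoc, h1, h2]
  ring

/-- A polynomial function of degree at most two has a polar form. -/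
lemma MvPolynomial.exists_hasPolarForm {ι : Type*} (ρ : MvPolynomial ι R)
    (hρ : ρ.totalDegree ≤ 2) : ∃ B, HasPolarForm (fun x => MvPolynomial.eval x ρ) B := by
  classical
  have mono : ∀ s ∈ ρ.support, ∃ B, HasPolarForm (fun x => ρ.coeff s * s.prod fun i k => x i ^ k) B := by
    intro s hs
    have hdeg : Multiset.card (Finsupp.toMultiset s) ≤ 2 := by
      rw [Finsupp.card_toMultiset]
      exact (MvPolynomial.le_totalDegree hs).trans hρ
    have hprod : ∀ x : ι → R, (s.prod fun i k => x i ^ k) = ((Finsupp.toMultiset s).map x).prod := by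
      intro x
      rw [Finsupp.toMultiset_map, Finsupp.prod_toMultiset, Finsupp.prod_mapDomain_index]
      · simp
      · intro b m n; exact pow_add _ _ _
    simp only [hprod]
    generalize Finsupp.toMultiset s = t at hdeg
    have : Multiset.card t = 0 ∨ Multiset.card t = 1 ∨ Multiset.card t = 2 := by omega
    rcases this with h | h | h
    · rw [Multiset.card_eq_zero] at h
      subst h
      exact ⟨0, fun x y => by simp⟩
    · obtain ⟨i, rfl⟩ := Multiset.card_eq_one.1 h
      exact ⟨0, fun x y => by simp [mul_add]⟩
    · obtain ⟨i, j, rfl⟩ := Multiset.card_eq_two.1 h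
      refine ⟨ρ.coeff s • ((LinearMap.mul R R).compl₁₂ (LinearMap.proj i) (LinearMap.proj j) +
        (LinearMap.mul R R).compl₁₂ (LinearMap.proj j) (LinearMap.proj i)), fun x y => ?_⟩
      simp
      ring
  choose! B hB using mono
  refine ⟨∑ s ∈ ρ.support, B s, fun x y => ?_⟩
  have heval : ∀ x, MvPolynomial.eval x ρ =
      ∑ s ∈ ρ.support, ρ.coeff s * s.prod fun i k => x i ^ k := fun x => MvPolynomial.eval_eq x ρ
  simp only [heval, LinearMap.sum_apply, ← Finset.sum_add_distrib, ← Finset.sum_sub_distrib]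
  exact Finset.sum_congr rfl fun s hs => hB s hs x y

/-- The point of `Rⁿ` attached to a position: `none` stands for the value of an operation and
`some i` for its `i`-th argument. -/
def positionVec {ι : Type*} [DecidableEq ι] : Option ι → ι → R
  | none => 0
  | some i => Pi.single i 1

/-- The weights on the positions given by a bilinear form. -/
def formWeight {ι : Type*} [DecidableEq ι] (B : (ι → R) →ₗ[R] (ι → R) →ₗ[R] R) (a b : Option ι) : R :=
  B (positionVec a) (positionVec b)

/-- The map replacing the `j`-th coordinate by minus the sum of all coordinates. -/
def negSumAt {ι : Type*} [DecidableEq ι] [Fintype ι] (j : ι) : (ι → R) →ₗ[R] (ι → R) where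
  toFun x := Function.update x j (-∑ i, x i)
  map_add' x y := by
    ext k
    by_cases hk : k = j
    · subst hk; simp [Finset.sum_add_distrib]; ring
    · simp [hk]
  map_smul' r x := by
    ext k
    by_cases hk : k = j
    · subst hk; simp [Finset.mul_sum]
    · simp [hk]

lemma negSumAt_positionVec {ι : Type*} [DecidableEq ι] [Fintype ι] (j : ι) (a : Option ι) :
    negSumAt (R := R) j (positionVec a) =
      positionVec (Equiv.swap none (some j) a) - positionVec (some j) := by
  ext k
  rcases a with _ | i
  · by_cases hk : k = j
    · subst hk; simp [negSumAt, positionVec]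
    · simp [negSumAt, positionVec, hk]
  · by_cases hi : i = j
    · subst hi
      by_cases hk : k = i
      · subst hk; simp [negSumAt, positionVec]
      · simp [negSumAt, positionVec, hk]
    · rw [Equiv.swap_apply_of_ne_of_ne (by simp) (by simpa using hi)]
      by_cases hk : k = j
      · subst hk; simp [negSumAt, positionVec, Ne.symm hi]
      · simp [negSumAt, positionVec, hk]

lemma formWeight_negSumAt {ι : Type*} [DecidableEq ι] [Fintype ι]
    (B : (ι → R) →ₗ[R] (ι → R) →ₗ[R] R) (j : ι) (a b : Option ι) :
    formWeight (B.compl₁₂ (negSumAt j) (negSumAt j)) a b =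
      formWeight B (Equiv.swap none (some j) a) (Equiv.swap none (some j) b) +
      (formWeight B (some j) (some j) - formWeight B (Equiv.swap none (some j) a) (some j)) +
      -formWeight B (some j) (Equiv.swap none (some j) b) := by
  simp only [formWeight, LinearMap.compl₁₂_apply, negSumAt_positionVec, map_sub, LinearMap.sub_apply]
  ring

/-- Inserting a zero coordinate at `i`. -/
def insertZero {m : ℕ} (i : Fin (m + 1)) : (Fin m → R) →ₗ[R] (Fin (m + 1) → R) where
  toFun x := i.insertNth 0 x
  map_add' x y := by
    ext k
    refine Fin.succAboveCases i ?_ (fun k => ?_) k <;> simp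
  map_smul' r x := by
    ext k
    refine Fin.succAboveCases i ?_ (fun k => ?_) k <;> simp

lemma insertZero_positionVec {m : ℕ} (i : Fin (m + 1)) (a : Option (Fin m)) :
    insertZero (R := R) i (positionVec a) = positionVec (a.map i.succAbove) := by
  ext k
  rcases a with _ | j
  · refine Fin.succAboveCases i ?_ (fun k => ?_) k <;> simp [insertZero, positionVec]
  · refine Fin.succAboveCases i ?_ (fun k => ?_) k
    · simp [insertZero, positionVec]
    · simp [insertZero, positionVec, Pi.single_apply]

end Quadratic

section Quasigroups

lemma isNQuasigroup_of_sum {q : ℕ} [NeZero q] {ι : Type*} [DecidableEq ι] [Fintype ι]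
    (ε : (ZMod q)ˣ) (c : ZMod q) (φ : (ι → ZMod q) → ZMod q)
    (Q : (ι → ZMod q × ZMod q) → ZMod q × ZMod q)
    (hQ : ∀ x, Q x = (ε * ∑ i, (x i).1 + c, ε * ∑ i, (x i).2 + φ fun i => (x i).1)) :
    IsNQuasigroup Q := by
  intro i x
  rw [← Finite.injective_iff_bijective]
  intro s t hst
  simp only [hQ, Prod.mk.injEq] at hst
  obtain ⟨h1, h2⟩ := hst
  have key : ∀ (π : ZMod q × ZMod q → ZMod q) (t : ZMod q × ZMod q),
      ∑ k, π (Function.update x i t k) = π t + ∑ k ∈ Finset.univ.erase i, π (x k) := by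
    intro π t
    rw [← Finset.add_sum_erase _ _ (Finset.mem_univ i), Function.update_self]
    congr 1
    exact Finset.sum_congr rfl fun k hk => by
      rw [Function.update_of_ne (Finset.ne_of_mem_erase hk)]
  have e1 : s.1 = t.1 := by
    rw [key Prod.fst, key Prod.fst] at h1
    simpa using h1
  have e2 : (fun k => (Function.update x i s k).1) = fun k => (Function.update x i t k).1 := by
    ext k
    by_cases hk : k = i
    · subst hk; simp [e1]
    · simp [hk]
  rw [key Prod.snd, key Prod.snd, e2] at h2
  exact Prod.ext e1 (by simpa using h2)

lemma QSep.polar_eq_zero {q n : ℕ} {f : (Fin n → ZMod q) → ZMod q} {b : ZMod q}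
    {B : (Fin n → ZMod q) →ₗ[ZMod q] (Fin n → ZMod q) →ₗ[ZMod q] ZMod q} (hf : HasPolarForm f B)
    {W : Set (Fin n)} (h : QSep (Qf f b) W) {i i' j : Fin n} (hi : i ∈ W) (hi' : i' ∈ W)
    (hj : j ∉ W) : B (Pi.single i 1 - Pi.single i' 1) (Pi.single j 1) = 0 := by
  classical
  obtain ⟨H, G, -, hG, hQ⟩ := h
  set u : Fin n → ZMod q := Pi.single i 1 - Pi.single i' 1 with hu
  set e : Fin n → ZMod q := Pi.single j 1 with he
  have hij : i ≠ j := by rintro rfl; exact hj hi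
  have hij' : i' ≠ j := by rintro rfl; exact hj hi'
  have hsum : ∑ k, u k = 0 := by simp [hu]
  set δ : Fin n → ZMod q := Pi.single i (f u - f 0) with hδ
  have hδsum : ∑ k, δ k = f u - f 0 := by simp [hδ]
  have huW : ∀ k, k ∉ W → u k = 0 := by
    intro k hk
    have h1 : k ≠ i := by rintro rfl; exact hk hi
    have h2 : k ≠ i' := by rintro rfl; exact hk hi'
    simp [hu, h1, h2]
  have hδW : ∀ k, k ∉ W → δ k = 0 := by
    intro k hk
    have h1 : k ≠ i := by rintro rfl; exact hk hi
    simp [hδ, h1]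
  have heW : ∀ k, k ∈ W → e k = 0 := by
    intro k hk
    have h1 : k ≠ j := by rintro rfl; exact hj hk
    simp [he, h1]
  have step : ∀ x : Fin n → ZMod q, Qf f b (fun k => (x k + u k, δ k)) =
      (-(∑ k, x k) + b, -(f u - f 0) + f (x + u)) := by
    intro x
    simp only [Qf, Finset.sum_add_distrib, hsum, hδsum, add_zero]
    rfl
  have step0 : ∀ x : Fin n → ZMod q, Qf f b (fun k => (x k, 0)) = (-(∑ k, x k) + b, f x) := by
    intro x
    simp [Qf]
  have hH : (H fun w : W => (0, 0)) = H fun w : W => ((0 : Fin n → ZMod q) w + u w, δ w) := by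
    have h1 := step 0
    have h2 := step0 0
    rw [zero_add, neg_sub, sub_add_cancel] at h1
    rw [← h2, hQ, hQ] at h1
    apply (hG (Sum.inr ()) (Sum.elim (fun _ => (0, 0)) fun _ => (0, 0))).1
    refine Eq.trans (congrArg G (funext fun k => ?_)) (h1.symm.trans (congrArg G (funext fun k => ?_)))
    · rcases k with k | k <;> simp
    · rcases k with k | k
      · simpa using ⟨huW k k.2, hδW k k.2⟩
      · simp
  have h1 := step e
  have h2 := step0 e
  rw [hQ] at h1 h2
  have hW1 : (fun w : W => (e w, (0 : ZMod q))) = fun w : W => (0, 0) := by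
    ext w : 1; simp [heW w w.2]
  have hW2 : (fun w : W => (e w + u w, δ w)) =
      fun w : W => ((0 : Fin n → ZMod q) w + u w, δ w) := by
    ext w : 1; simp [heW w w.2]
  have hW3 : (fun w : ↥Wᶜ => (e w + u w, δ w)) = fun w : ↥Wᶜ => (e w, 0) := by
    ext w : 1; simp [huW w w.2, hδW w w.2]
  rw [hW2, hW3, ← hH] at h1
  rw [hW1, h1] at h2
  have h3 := congrArg Prod.snd h2
  simp only at h3
  have h4 := hf e u
  rw [hf.symm]
  linear_combination h3 - h4

lemma QSep.isSplit {q n : ℕ} [Fact q.Prime] {f : (Fin n → ZMod q) → ZMod q} {b : ZMod q}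
    {B : (Fin n → ZMod q) →ₗ[ZMod q] (Fin n → ZMod q) →ₗ[ZMod q] ZMod q} (hf : HasPolarForm f B)
    {W : Set (Fin n)} (h : QSep (Qf f b) W) (h2 : 2 ≤ W.ncard) (hn : W.ncard ≤ n - 1) :
    ∃ A, IsSplit (formWeight B) Finset.univ A := by
  classical
  refine ⟨W.toFinset.map Function.Embedding.some, Finset.subset_univ _, ?_, ?_, ?_⟩
  · rwa [Finset.card_map, ← Set.ncard_eq_toFinset_card']
  · rw [Finset.card_sdiff_of_subset (Finset.subset_univ _), Finset.card_map,
      ← Set.ncard_eq_toFinset_card']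
    simp
    omega
  · intro a ha a' ha' c hc c' hc'
    simp only [Finset.mem_map, Set.mem_toFinset, Function.Embedding.some_apply,
      Finset.mem_sdiff, Finset.mem_univ, true_and, not_exists, not_and] at ha ha' hc hc'
    obtain ⟨i, hi, rfl⟩ := ha
    obtain ⟨i', hi', rfl⟩ := ha'
    have key : ∀ c : Option (Fin n), (∀ x ∈ W, ¬ some x = c) →
        formWeight B (some i) c = formWeight B (some i') c := by
      rintro (_ | j) hc
      · simp [formWeight, positionVec]
      · have := h.polar_eq_zero hf hi hi' (fun hj => hc j hj rfl)
        rw [map_sub, LinearMap.sub_apply, sub_eq_zero] at this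
        exact this
    rw [key c hc, key c' hc']
    ring

lemma IsInvAt.unique {S : Type*} {n : ℕ} {Q Q₁ Q₂ : (Fin n → S) → S} {j : Fin n}
    (h₁ : IsInvAt Q Q₁ j) (h₂ : IsInvAt Q Q₂ j) : Q₁ = Q₂ := by
  ext z
  set x := Function.update z j (Q₁ z) with hx
  have hz : Function.update x j (z j) = z := by simp [hx]
  have h := (h₁ x (z j)).2 (by rw [hz]; simp [hx])
  have h' := (h₂ x (z j)).1 h
  rw [hz] at h'
  rw [← h']
  simp [hx]

/-- The inverses of `Q_{f,b}` are again of this form. -/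
lemma isInvAt_Qf {q n : ℕ} (f : (Fin n → ZMod q) → ZMod q) (b : ZMod q) (j : Fin n) :
    IsInvAt (Qf f b) (Qf (fun x => f (negSumAt j x + Pi.single j b)) b) j := by
  intro x x0
  have key : ∀ π : ZMod q × ZMod q → ZMod q, ∑ k, π (Function.update x j x0 k) =
      π x0 + ∑ k ∈ Finset.univ.erase j, π (x k) := by
    intro π
    rw [← Finset.add_sum_erase _ _ (Finset.mem_univ j), Function.update_self]
    congr 1
    exact Finset.sum_congr rfl fun k hk => by
      rw [Function.update_of_ne (Finset.ne_of_mem_erase hk)]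
  have key' : ∀ π : ZMod q × ZMod q → ZMod q, ∑ k, π (x k) =
      π (x j) + ∑ k ∈ Finset.univ.erase j, π (x k) := fun π =>
    (Finset.add_sum_erase _ _ (Finset.mem_univ j)).symm
  simp only [Qf, Prod.ext_iff]
  have hiff : x0.1 = -(∑ i, (x i).1) + b ↔
      (x j).1 = -(∑ i, (Function.update x j x0 i).1) + b := by
    rw [key Prod.fst, key' Prod.fst]
    constructor <;> intro h <;> linear_combination h
  rw [← hiff]
  refine and_congr_right fun h => ?_
  have harg : negSumAt j (fun i => (Function.update x j x0 i).1) + Pi.single j b =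
      fun i => (x i).1 := by
    ext k
    by_cases hk : k = j
    · subst hk
      have := hiff.1 h
      simp only [negSumAt, LinearMap.coe_mk, AddHom.coe_mk, Pi.add_apply, Function.update_self,
        Pi.single_eq_same]
      exact this.symm
    · simp [negSumAt, hk]
  rw [harg, key Prod.snd, key' Prod.snd]
  constructor <;> intro h <;> linear_combination h

lemma QSeparable.isSplit {q n : ℕ} [Fact q.Prime] {f : (Fin n → ZMod q) → ZMod q} {b : ZMod q}
    {B : (Fin n → ZMod q) →ₗ[ZMod q] (Fin n → ZMod q) →ₗ[ZMod q] ZMod q} (hf : HasPolarForm f B)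
    (h : QSeparable (Qf f b)) : ∃ A, IsSplit (formWeight B) Finset.univ A := by
  obtain ⟨W, h2, hn, hW | ⟨j, Q', hQ', hW⟩⟩ := h
  · exact hW.isSplit hf h2 hn
  · rw [hQ'.unique (isInvAt_Qf f b j)] at hW
    have hg := hf.comp_affine (negSumAt j) (Pi.single j b) 0
    simp only [add_zero] at hg
    obtain ⟨A, hA⟩ := hW.isSplit hg h2 hn
    have := hA.map (Equiv.swap none (some j)).toEmbedding _ _ (formWeight_negSumAt B j)
    rw [Finset.map_univ_equiv] at this
    exact ⟨_, this⟩

lemma IsSplit.qSeparable {q n : ℕ} [Fact q.Prime] {f : (Fin n → ZMod q) → ZMod q} {b : ZMod q}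
    {B : (Fin n → ZMod q) →ₗ[ZMod q] (Fin n → ZMod q) →ₗ[ZMod q] ZMod q} (hf : HasPolarForm f B)
    {A : Finset (Option (Fin n))} (hA : IsSplit (formWeight B) Finset.univ A) (hnone : none ∉ A) :
    QSeparable (Qf f b) := by
  classical
  obtain ⟨-, h2, h2', hw⟩ := hA
  set W : Set (Fin n) := {i | some i ∈ A} with hW
  have hAW : A = W.toFinset.map Function.Embedding.some := by
    ext (_ | i) <;> simp [hW, hnone]
  have hcard : W.ncard = A.card := by
    rw [hAW, Finset.card_map, Set.ncard_eq_toFinset_card']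
  rw [Finset.card_sdiff_of_subset (Finset.subset_univ _), Finset.card_univ, Fintype.card_option,
    Fintype.card_fin] at h2'
  obtain ⟨i₀, hi₀⟩ : W.Nonempty := by
    rw [← Set.ncard_pos]
    omega
  have hB : ∀ i ∈ W, ∀ j ∉ W, B (Pi.single i 1) (Pi.single j 1) = B (Pi.single i₀ 1) (Pi.single j 1) := by
    intro i hi j hj
    have := hw (some i) hi (some i₀) hi₀ (some j) (by simpa [hW] using hj) none (by simpa using hnone)
    simpa [formWeight, positionVec] using this
  have expand : ∀ z y, B z y = ∑ j, y j * B z (Pi.single j 1) := by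
    intro z y
    conv_lhs => rw [pi_eq_sum_univ' y]
    simp
  have hbil : ∀ x y : Fin n → ZMod q, (∀ k ∉ W, x k = 0) → (∀ k ∈ W, y k = 0) →
      B x y = (∑ k, x k) * B (Pi.single i₀ 1) y := by
    intro x y hx hy
    rw [hf.symm, expand, Finset.sum_mul]
    refine Finset.sum_congr rfl fun k _ => ?_
    by_cases hk : k ∈ W
    · rw [hf.symm, expand, expand]
      congr 1
      refine Finset.sum_congr rfl fun j _ => ?_
      by_cases hj : j ∈ W
      · rw [hy j hj, zero_mul, zero_mul]
      · rw [hB k hk j hj]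
    · rw [hx k hk, zero_mul, zero_mul]
  have hsplit : ∀ π : Fin n → ZMod q, ∑ w : W, π w + ∑ u : ↥Wᶜ, π u = ∑ k, π k := fun π =>
    Fintype.sum_subtype_add_sum_subtype (· ∈ W) π
  let extW : (W → ZMod q) → Fin n → ZMod q := fun h k => if hk : k ∈ W then h ⟨k, hk⟩ else 0
  let extC : (↥Wᶜ → ZMod q) → Fin n → ZMod q := fun g k => if hk : k ∈ W then 0 else g ⟨k, hk⟩
  refine ⟨W, by omega, by omega, Or.inl
    ⟨fun h => (∑ w, (h w).1, ∑ w, (h w).2 - f (extW fun w => (h w).1)),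
     fun g => (-∑ v, (g v).1 + b, -∑ v, (g v).2 + (f (extC fun u => (g (Sum.inl u)).1) - f 0 +
      (g (Sum.inr ())).1 * B (Pi.single i₀ 1) (extC fun u => (g (Sum.inl u)).1))), ?_, ?_, ?_⟩⟩
  · exact isNQuasigroup_of_sum 1 0 (fun h => -f (extW h)) _ fun h => by simp [sub_eq_add_neg]
  · exact isNQuasigroup_of_sum (-1) b (fun g => f (extC fun u => g (Sum.inl u)) - f 0 +
      g (Sum.inr ()) * B (Pi.single i₀ 1) (extC fun u => g (Sum.inl u))) _ fun h => by simp
  · intro x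
    set xW := extW fun w => (x w).1 with hxW
    set xC := extC fun w => (x w).1 with hxC
    have hx : (fun k => (x k).1) = xW + xC := by
      ext k
      by_cases hk : k ∈ W <;> simp [hxW, hxC, extW, extC, hk]
    have hsumW : ∑ k, xW k = ∑ w : W, (x w).1 := by
      rw [← hsplit, Finset.sum_eq_zero (s := (Finset.univ : Finset ↥Wᶜ)), add_zero]
      · exact Finset.sum_congr rfl fun w _ => by simp [hxW, extW]
      · intro u _
        simp only [hxW, extW]
        exact dif_neg u.2
    have hb := hbil xW xC (fun k hk => by simp [hxW, extW, hk]) fun k hk => by simp [hxC, extC, hk]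
    have h1 := hsplit fun k => (x k).1
    have h2 := hsplit fun k => (x k).2
    rw [hsumW] at hb
    simp only [Qf, ← h1, ← h2]
    simp only [hx, hf xW xC, Fintype.sum_sum_type, Sum.elim_inl, Sum.elim_inr,
      Finset.univ_unique, Finset.sum_singleton, Prod.mk.injEq, hb, ← hxC]
    constructor <;> ring

/-- A separable retract of `Q_{f,b}` in the `i`-th argument splits the remaining positions. -/
lemma QSeparable.isSplit_of_insertNth {q m : ℕ} [Fact q.Prime] {f : (Fin (m + 1) → ZMod q) → ZMod q}
    {b : ZMod q} {B : (Fin (m + 1) → ZMod q) →ₗ[ZMod q] (Fin (m + 1) → ZMod q) →ₗ[ZMod q] ZMod q}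
    (hf : HasPolarForm f B) {i : Fin (m + 1)} {z : ZMod q × ZMod q}
    (h : QSeparable fun y : Fin m → ZMod q × ZMod q => Qf f b (i.insertNth z y)) :
    ∃ A, IsSplit (formWeight B) (Finset.univ.erase (some i)) A := by
  have hQ : (fun y : Fin m → ZMod q × ZMod q => Qf f b (i.insertNth z y)) =
      Qf (fun x => f (insertZero i x + Pi.single i z.1) + -z.2) (b - z.1) := by
    ext1 y
    have harg : (insertZero i fun k => (y k).1) + Pi.single i z.1 =
        fun k => ((i.insertNth z y : Fin (m + 1) → ZMod q × ZMod q) k).1 := by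
      ext k
      refine Fin.succAboveCases i ?_ (fun k => ?_) k <;> simp [insertZero]
    simp only [Qf, harg, Fin.sum_univ_succAbove _ i, Fin.insertNth_apply_same,
      Fin.insertNth_apply_succAbove, Prod.mk.injEq]
    constructor <;> ring
  rw [hQ] at h
  obtain ⟨A, hA⟩ := h.isSplit (hf.comp_affine (insertZero i) (Pi.single i z.1) (-z.2))
  have hmap := hA.map (w := formWeight B) i.succAboveEmb.optionMap 0 0 fun a b => by
    simp [formWeight, insertZero_positionVec]
  have huniv : Finset.univ.map i.succAboveEmb.optionMap = Finset.univ.erase (some i) := by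
    ext (_ | k)
    · simp
    · refine Fin.succAboveCases i ?_ (fun k => ?_) k
      · simp
      · simp
  rw [huniv] at hmap
  exact ⟨_, hmap⟩

end Quasigroups

/-- Let `q > 2` be prime and `f : (ZMod q)^{m+1} → ZMod q` a quadratic function,
`m + 1 ≥ 4`. If every `m`-ary retract of the `(m+1)`-ary quasigroup `Q_{f,a}` of order
`q²` — i.e. every `m`-ary quasigroup obtained from `Q_{f,a}` or from one of its inverses
by substituting a constant for one argument — is separable, then `Q_{f,a}` itself is
separable. -/
theorem qf_separable_of_retracts {q m : ℕ} (hq : q.Prime) (hq2 : 2 < q)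
    (hm : 4 ≤ m + 1) (a : ZMod q)
    (f : (Fin (m + 1) → ZMod q) → ZMod q)
    (ρ : MvPolynomial (Fin (m + 1)) (ZMod q)) (hρ : ρ.totalDegree ≤ 2)
    (hf : f = fun x => MvPolynomial.eval x ρ)
    (hretr : ∀ Q' : (Fin (m + 1) → ZMod q × ZMod q) → ZMod q × ZMod q,
      (Q' = Qf f a ∨ ∃ j, IsInvAt (Qf f a) Q' j) →
      ∀ (i : Fin (m + 1)) (z : ZMod q × ZMod q),
        QSeparable fun y : Fin m → ZMod q × ZMod q => Q' (i.insertNth z y)) :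
    QSeparable (Qf f a) := by
  have : Fact q.Prime := ⟨hq⟩
  have h2 : (2 : ZMod q) ≠ 0 := by
    intro h
    have h' : ((2 : ℕ) : ZMod q) = 0 := by exact_mod_cast h
    rw [ZMod.natCast_eq_zero_iff] at h'
    exact absurd (Nat.le_of_dvd two_pos h') (by omega)
  obtain ⟨B, hB⟩ := MvPolynomial.exists_hasPolarForm ρ hρ
  rw [← hf] at hB
  have hw : ∀ a b, formWeight B a b = formWeight B b a := fun _ _ => hB.symm _ _
  by_contra hsep
  have hfree : SplitFree (formWeight B) Finset.univ := by
    intro A hA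
    by_cases hnone : none ∈ A
    · exact hsep ((hA.compl hw).qSeparable hB (by simp [hnone]))
    · exact hsep (hA.qSeparable hB hnone)
  obtain ⟨v, -, hv⟩ := hfree.exists_erase hw h2 (by simp; omega)
  rcases v with _ | i
  · have hg := hB.comp_affine (negSumAt 0) (Pi.single 0 a) 0
    simp only [add_zero] at hg
    obtain ⟨A, hA⟩ := QSeparable.isSplit_of_insertNth hg
      (hretr _ (Or.inr ⟨0, isInvAt_Qf f a 0⟩) 0 0)
    have hmap := hA.map (Equiv.swap none (some 0)).toEmbedding _ _ (formWeight_negSumAt B 0)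
    rw [Finset.map_erase, Finset.map_univ_equiv, Equiv.coe_toEmbedding,
      Equiv.swap_apply_right] at hmap
    exact hv _ hmap
  · obtain ⟨A, hA⟩ := QSeparable.isSplit_of_insertNth hB (hretr _ (Or.inl rfl) i 0)
    exact hv A hA
end
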